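/- arXiv:1405.7916 — 10 statements merged into one kernel-verified Lean document; each statement's English description precedes it below -/
import Mathlib

section
/- The horizon radii satisfy the strict inequalities 2M < r_b < 3M < r_c. -/
/-- Schwarzschild–de Sitter horizon radii satisfy `2M < r_b < 3M < r_c`. -/
theorem stmt_3 (M Λ : ℝ) (hM : 0 < M) (hΛ : 0 < Λ)
    (F : ℝ → ℝ) (hF : ∀ r, F r = 1 - 2*M/r - Λ/3 * r^2)
    (h : 3*M*Real.sqrt Λ < 1)
    (ξ rb rc : ℝ)
    (hξ : ξ = 2*Real.pi - Real.arccos (-(3*M*Real.sqrt Λ)))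
    (hrb : rb = 2/Real.sqrt Λ * Real.cos (ξ/3))
    (hrc : rc = 2/Real.sqrt Λ * Real.cos (ξ/3 + 4*Real.pi/3)) :
    2*M < rb ∧ rb < 3*M ∧ 3*M < rc := by
  have hs : 0 < Real.sqrt Λ := Real.sqrt_pos.mpr hΛ
  generalize Real.sqrt Λ = s at *
  have hm : 0 < 3*M*s := by positivity
  rw [Real.arccos_neg] at hξ
  have ha0 : 0 < Real.arccos (3*M*s) := Real.arccos_pos.mpr h
  have ha1 : Real.arccos (3*M*s) < Real.pi/2 := Real.arccos_lt_pi_div_two.mpr hm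
  have hca : Real.cos (Real.arccos (3*M*s)) = 3*M*s :=
    Real.cos_arccos (by linarith) h.le
  have hcξ : Real.cos ξ = -(3*M*s) := by
    rw [hξ, show 2*Real.pi - (Real.pi - Real.arccos (3*M*s))
      = Real.arccos (3*M*s) + Real.pi by ring, Real.cos_add_pi, hca]
  have h3 := Real.cos_three_mul (ξ/3)
  rw [show 3*(ξ/3) = ξ by ring, hcξ] at h3
  have hx0 : 0 < Real.cos (ξ/3) :=
    Real.cos_pos_of_mem_Ioo ⟨by linarith, by linarith⟩
  have hx1 : Real.cos (ξ/3) < 1/2 := by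
    rw [← Real.cos_pi_div_three]
    exact Real.cos_lt_cos_of_nonneg_of_le_pi (by linarith) (by linarith) (by linarith)
  have hy : 1/2 < Real.cos (ξ/3 + 4*Real.pi/3) := by
    rw [show ξ/3 + 4*Real.pi/3 = 2*Real.pi - (2*Real.pi/3 - ξ/3) by ring,
      Real.cos_two_pi_sub, ← Real.cos_pi_div_three]
    exact Real.cos_lt_cos_of_nonneg_of_le_pi (by linarith) (by linarith) (by linarith)
  generalize Real.cos (ξ/3) = x at *
  generalize Real.cos (ξ/3 + 4*Real.pi/3) = y at *
  have hx3 : 0 < x^3 := by positivity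
  have hx4 : 0 < x*((1-2*x)*(1+2*x)) :=
    mul_pos hx0 (mul_pos (by linarith) (by linarith))
  rw [hrb, hrc, div_mul_eq_mul_div, div_mul_eq_mul_div, lt_div_iff₀ hs, div_lt_iff₀ hs,
    lt_div_iff₀ hs]
  refine ⟨by nlinarith, by nlinarith, by nlinarith⟩
end

section
/- For every r in the open interval (r_b, r_c), the tortoise coordinate r_* is differentiable at r with derivative dr_*/dr = 1/F(r). -/
/-- On `(r_b, r_c)` the tortoise coordinate `r_*` is differentiable with
derivative `1/F(r)`. -/
theorem stmt_8 (M Λ : ℝ) (hM : 0 < M) (hΛ : 0 < Λ)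
    (F : ℝ → ℝ) (hF : ∀ r, F r = 1 - 2*M/r - Λ/3 * r^2)
    (rb rc : ℝ) (hrb : 0 < rb) (hbc : rb < rc)
    (hFb : F rb = 0) (hFc : F rc = 0)
    (κb κc : ℝ)
    (hκb : κb = (rc - rb)*(rc + 2*rb)*Λ/(6*rb))
    (hκc : κc = (rc - rb)*(2*rc + rb)*Λ/(6*rc))
    (rstar : ℝ → ℝ)
    (hrstar : ∀ r, rstar r = 1/(2*κb) * Real.log (r/rb - 1)
      - 1/(2*κc) * Real.log (1 - r/rc)
      - (1/2)*(1/κb - 1/κc) * Real.log (r/(rb + rc) + 1)) :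
    ∀ r ∈ Set.Ioo rb rc, HasDerivAt rstar (1/(F r)) r := by
  intro r hr
  obtain ⟨h1, h2⟩ := hr
  have hr0 : 0 < r := by linarith
  have hrc : 0 < rc := by linarith
  have a1 : 0 < r - rb := by linarith
  have a2 : 0 < rc - r := by linarith
  have a3 : 0 < rc - rb := by linarith
  have a4 : 0 < r + (rb + rc) := by linarith
  have a5 : 0 < rc + 2 * rb := by linarith
  have a6 : 0 < 2 * rc + rb := by linarith
  have a7 : 0 < rb + rc := by linarith
  have eb : rb - 2*M - Λ/3 * rb^3 = 0 := by
    have h := hFb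
    rw [hF] at h
    have : rb * (1 - 2*M/rb - Λ/3 * rb^2) = rb - 2*M - Λ/3 * rb^3 := by
      field_simp
    rw [← this, h, mul_zero]
  have ec : rc - 2*M - Λ/3 * rc^3 = 0 := by
    have h := hFc
    rw [hF] at h
    have : rc * (1 - 2*M/rc - Λ/3 * rc^2) = rc - 2*M - Λ/3 * rc^3 := by
      field_simp
    rw [← this, h, mul_zero]
  have e1 : 1 = Λ/3 * (rb^2 + rb*rc + rc^2) := by
    apply mul_left_cancel₀ a3.ne'
    linear_combination ec - eb
  have e2 : 2*M = Λ/3 * (rb*rc*(rb+rc)) := by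
    linear_combination rb * e1 - eb
  have hFr : F r = Λ * (r - rb) * (rc - r) * (r + (rb + rc)) / (3 * r) := by
    rw [hF, eq_div_iff (by positivity)]
    have : (1 - 2*M/r - Λ/3 * r^2) * (3*r) = 3 * (r - 2*M - Λ/3 * r^3) := by
      field_simp
    rw [this]
    linear_combination 3 * r * e1 - 3 * e2
  have b1 : r/rb - 1 = (r - rb)/rb := by field_simp
  have b2 : 1 - r/rc = (rc - r)/rc := by field_simp
  have b3 : r/(rb+rc) + 1 = (r + (rb + rc))/(rb+rc) := by field_simp
  have n1 : r/rb - 1 ≠ 0 := by rw [b1]; positivity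
  have n2 : 1 - r/rc ≠ 0 := by rw [b2]; positivity
  have n3 : r/(rb+rc) + 1 ≠ 0 := by rw [b3]; positivity
  have d1 := ((((hasDerivAt_id' r).div_const rb).sub_const 1).log n1).const_mul (1/(2*κb))
  have d2 := ((((hasDerivAt_id' r).div_const rc).const_sub 1).log n2).const_mul (1/(2*κc))
  have d3 := ((((hasDerivAt_id' r).div_const (rb+rc)).add_const 1).log n3).const_mul
    ((1/2)*(1/κb - 1/κc))
  have d := (d1.sub d2).sub d3
  have hfun : rstar = _ := funext hrstar
  rw [hfun]
  refine HasDerivAt.congr_deriv d ?_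
  rw [hFr, b1, b2, b3, hκb, hκc]
  have := a1.ne'
  have := a2.ne'
  have := a3.ne'
  have := a4.ne'
  have := a5.ne'
  have := a6.ne'
  have := a7.ne'
  field_simp
  ring
end

section
/- The tortoise coordinate r_* is strictly increasing on (r_b, r_c), tends to −∞ as r → r_b from the right, and tends to +∞ as r → r_c from the left; consequently r_* maps the interval (r_b, r_c) onto all of ℝ. -/
/-- The tortoise coordinate `r_*` is strictly increasing on `(r_b, r_c)`, tends to
`−∞` as `r → r_b⁺` and to `+∞` as `r → r_c⁻`; consequently it maps `(r_b, r_c)`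
onto all of `ℝ`. -/
theorem stmt_9 (M Λ : ℝ) (hM : 0 < M) (hΛ : 0 < Λ)
    (F : ℝ → ℝ) (hF : ∀ r, F r = 1 - 2*M/r - Λ/3 * r^2)
    (rb rc : ℝ) (hrb : 0 < rb) (hbc : rb < rc)
    (hFb : F rb = 0) (hFc : F rc = 0)
    (κb κc : ℝ)
    (hκb : κb = (rc - rb)*(rc + 2*rb)*Λ/(6*rb))
    (hκc : κc = (rc - rb)*(2*rc + rb)*Λ/(6*rc))
    (rstar : ℝ → ℝ)
    (hrstar : ∀ r, rstar r = 1/(2*κb) * Real.log (r/rb - 1)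
      - 1/(2*κc) * Real.log (1 - r/rc)
      - (1/2)*(1/κb - 1/κc) * Real.log (r/(rb + rc) + 1)) :
    StrictMonoOn rstar (Set.Ioo rb rc) ∧
    Filter.Tendsto rstar (nhdsWithin rb (Set.Ioi rb)) Filter.atBot ∧
    Filter.Tendsto rstar (nhdsWithin rc (Set.Iio rc)) Filter.atTop ∧
    rstar '' (Set.Ioo rb rc) = Set.univ := by
  have hrc : 0 < rc := hrb.trans hbc
  have hd : 0 < rc - rb := sub_pos.2 hbc
  have hs : 0 < rb + rc := by positivity
  have hb0 : 0 < κb := by rw [hκb]; positivity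
  have hc0 : 0 < κc := by rw [hκc]; positivity
  have hlt : κc < κb := by
    rw [hκb, hκc, div_lt_div_iff₀ (by positivity) (by positivity)]
    have : 0 < 6 * ((rc - rb) * Λ * ((rc - rb) * (rc + rb))) := by positivity
    have h2 : 0 < 6 * ((rc - rb) * Λ * ((rc - rb) * (rc + rb))) := this
    nlinarith [h2]
  have hcc : (1/2)*(1/κb - 1/κc) < 0 := by
    have := one_div_lt_one_div_of_lt hc0 hlt
    linarith
  have ha : 0 < 1/(2*κb) := by positivity
  have hb : 0 < 1/(2*κc) := by positivity
  have hfun : rstar = fun r => 1/(2*κb) * Real.log (r/rb - 1)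
      - 1/(2*κc) * Real.log (1 - r/rc)
      - (1/2)*(1/κb - 1/κc) * Real.log (r/(rb + rc) + 1) := funext hrstar
  clear hrstar
  generalize 1/(2*κb) = a at *
  generalize 1/(2*κc) = b at *
  generalize (1/2)*(1/κb - 1/κc) = c at *
  have p1 : ∀ r, rb < r → 0 < r/rb - 1 := fun r h => by
    rw [sub_pos, lt_div_iff₀ hrb]; linarith
  have p2 : ∀ r, r < rc → 0 < 1 - r/rc := fun r h => by
    rw [sub_pos, div_lt_iff₀ hrc]; linarith
  have p3 : ∀ r, 0 < r → 0 < r/(rb+rc) + 1 := fun r h => by positivity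
  have hmono : StrictMonoOn rstar (Set.Ioo rb rc) := by
    intro x hx y hy hxy
    have h1 : Real.log (x/rb - 1) < Real.log (y/rb - 1) :=
      Real.log_lt_log (p1 x hx.1) (by gcongr)
    have h2 : Real.log (1 - y/rc) < Real.log (1 - x/rc) :=
      Real.log_lt_log (p2 y hy.2) (by gcongr)
    have h3 : Real.log (x/(rb+rc) + 1) < Real.log (y/(rb+rc) + 1) :=
      Real.log_lt_log (p3 x (hrb.trans hx.1)) (by gcongr)
    simp only [hfun]
    have e1 := mul_lt_mul_of_pos_left h1 ha
    have e2 := mul_lt_mul_of_pos_left h2 hb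
    have e3 := mul_lt_mul_of_neg_left h3 hcc
    linarith
  have c1 : ∀ r, rb < r → ContinuousAt (fun r => a * Real.log (r/rb - 1)) r := fun r h =>
    continuousAt_const.mul (ContinuousAt.log (by fun_prop) (p1 r h).ne')
  have c2 : ∀ r, r < rc → ContinuousAt (fun r => b * Real.log (1 - r/rc)) r := fun r h =>
    continuousAt_const.mul (ContinuousAt.log (by fun_prop) (p2 r h).ne')
  have c3 : ∀ r, 0 < r → ContinuousAt (fun r => c * Real.log (r/(rb+rc) + 1)) r := fun r h =>
    continuousAt_const.mul (ContinuousAt.log (by fun_prop) (p3 r h).ne')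
  have hbot : Filter.Tendsto rstar (nhdsWithin rb (Set.Ioi rb)) Filter.atBot := by
    have t0 : Filter.Tendsto (fun r => r/rb - 1) (nhdsWithin rb (Set.Ioi rb))
        (nhdsWithin 0 (Set.Ioi 0)) := by
      apply tendsto_nhdsWithin_of_tendsto_nhds_of_eventually_within
      · have : ContinuousAt (fun r => r/rb - 1) rb := by fun_prop
        have h := this.tendsto
        simp only [div_self hrb.ne', sub_self] at h
        exact h.mono_left nhdsWithin_le_nhds
      · filter_upwards [self_mem_nhdsWithin] with r hr using p1 r hr
    have t1 := (Real.tendsto_log_nhdsGT_zero.comp t0).const_mul_atBot ha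
    have t2 := ((c2 rb hbc).add (c3 rb hrb)).tendsto.mono_left
      (nhdsWithin_le_nhds (s := Set.Ioi rb))
    have t := t1.atBot_add t2.neg
    refine t.congr fun r => ?_
    simp only [hfun, Function.comp, Pi.add_apply, Pi.sub_apply]
    ring
  have htop : Filter.Tendsto rstar (nhdsWithin rc (Set.Iio rc)) Filter.atTop := by
    have t0 : Filter.Tendsto (fun r => 1 - r/rc) (nhdsWithin rc (Set.Iio rc))
        (nhdsWithin 0 (Set.Ioi 0)) := by
      apply tendsto_nhdsWithin_of_tendsto_nhds_of_eventually_within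
      · have : ContinuousAt (fun r => 1 - r/rc) rc := by fun_prop
        have h := this.tendsto
        simp only [div_self hrc.ne', sub_self] at h
        exact h.mono_left nhdsWithin_le_nhds
      · filter_upwards [self_mem_nhdsWithin] with r hr using p2 r hr
    have t1 := (Real.tendsto_log_nhdsGT_zero.comp t0).const_mul_atBot_of_neg (neg_lt_zero.2 hb)
    have t2 := ((c1 rc hbc).sub (c3 rc hrc)).tendsto.mono_left
      (nhdsWithin_le_nhds (s := Set.Iio rc))
    have t := t1.atTop_add t2
    refine t.congr fun r => ?_
    simp only [hfun, Function.comp, Pi.add_apply, Pi.sub_apply]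
    ring
  refine ⟨hmono, hbot, htop, ?_⟩
  have hcont : ContinuousOn rstar (Set.Ioo rb rc) := by
    intro r hr
    rw [hfun]
    exact (((c1 r hr.1).sub (c2 r hr.2)).sub (c3 r (hrb.trans hr.1))).continuousWithinAt
  have hsurj := hcont.surjOn_of_tendsto (Set.nonempty_Ioo.2 hbc)
    ((tendsto_comp_coe_Ioo_atBot hbc).2 hbot) ((tendsto_comp_coe_Ioo_atTop hbc).2 htop)
  exact Set.eq_univ_of_univ_subset hsurj
end

section
/- For every r ∈ (r_b, r_c), the conformal factor of the metric in the Kruskal coordinates regular at the black-hole horizon satisfies the identity F(r)·exp(−2κ_b·r_*(r)) = (2M/r)·(1 − r/r_c)^{1 + κ_b/κ_c}·(r/(r_b + r_c) + 1)^{2 − κ_b/κ_c}. -/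
/-- Conformal factor in the Kruskal coordinates regular at the black-hole horizon:
for `r ∈ (r_b, r_c)`,
`F(r)·exp(−2κ_b r_*(r)) = (2M/r)(1 − r/r_c)^{1+κ_b/κ_c}(r/(r_b+r_c) + 1)^{2−κ_b/κ_c}`. -/
theorem stmt_10 (M Λ : ℝ) (hM : 0 < M) (hΛ : 0 < Λ)
    (F : ℝ → ℝ) (hF : ∀ r, F r = 1 - 2*M/r - Λ/3 * r^2)
    (rb rc : ℝ) (hrb : 0 < rb) (hbc : rb < rc)
    (hFb : F rb = 0) (hFc : F rc = 0)
    (κb κc : ℝ)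
    (hκb : κb = (rc - rb)*(rc + 2*rb)*Λ/(6*rb))
    (hκc : κc = (rc - rb)*(2*rc + rb)*Λ/(6*rc))
    (rstar : ℝ → ℝ)
    (hrstar : ∀ r, rstar r = 1/(2*κb) * Real.log (r/rb - 1)
      - 1/(2*κc) * Real.log (1 - r/rc)
      - (1/2)*(1/κb - 1/κc) * Real.log (r/(rb + rc) + 1)) :
    ∀ r ∈ Set.Ioo rb rc,
      F r * Real.exp (-(2*κb*rstar r)) =
        2*M/r * (1 - r/rc) ^ ((1 + κb/κc : ℝ)) * (r/(rb + rc) + 1) ^ ((2 - κb/κc : ℝ)) := by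
  intro r hr
  obtain ⟨h1, h2⟩ := hr
  have hrc : 0 < rc := hrb.trans hbc
  have hr0 : 0 < r := hrb.trans h1
  have hd : 0 < rc - rb := sub_pos.2 hbc
  have hs : 0 < rb + rc := by positivity
  have hκb0 : 0 < κb := by rw [hκb]; positivity
  have hκc0 : 0 < κc := by rw [hκc]; positivity
  have hA : 0 < r/rb - 1 := by rw [sub_pos, lt_div_iff₀ hrb]; linarith
  have hB : 0 < 1 - r/rc := by rw [sub_pos, div_lt_iff₀ hrc]; linarith
  have hC : 0 < r/(rb + rc) + 1 := by positivity
  have eb : 3*rb - 6*M - Λ*rb^3 = 0 := by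
    rw [hF] at hFb; field_simp at hFb; linarith
  have ec : 3*rc - 6*M - Λ*rc^3 = 0 := by
    rw [hF] at hFc; field_simp at hFc; linarith
  have e3 : Λ*(rb^2+rb*rc+rc^2) = 3 := by
    apply mul_left_cancel₀ hd.ne'
    linear_combination eb - ec
  have e6 : 6*M = Λ*(rb*rc*(rb+rc)) := by
    linear_combination -eb - rb * e3
  have hM' : M = Λ*(rb*rc*(rb+rc))/6 := by linarith
  have hFr : F r = 2*M/r * ((r/rb - 1) * (1 - r/rc) * (r/(rb + rc) + 1)) := by
    rw [hF, hM']
    field_simp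
    linear_combination (-6*r) * e3
  have hE : Real.exp (-(2*κb*rstar r)) = (r/rb - 1)⁻¹ * (1 - r/rc)^(κb/κc)
      * (r/(rb + rc) + 1)^(1 - κb/κc) := by
    rw [Real.rpow_def_of_pos hB, Real.rpow_def_of_pos hC]
    nth_rewrite 1 [← Real.exp_log hA]
    rw [← Real.exp_neg, ← Real.exp_add, ← Real.exp_add, hrstar]
    congr 1
    generalize Real.log (r/rb - 1) = a
    generalize Real.log (1 - r/rc) = b
    generalize Real.log (r/(rb + rc) + 1) = c
    clear hκb hκc
    field_simp
    ring
  have e2 : (2 - κb/κc : ℝ) = 1 + (1 - κb/κc) := by ring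
  rw [hFr, hE, e2, Real.rpow_add hB, Real.rpow_add hC, Real.rpow_one, Real.rpow_one]
  generalize (1 - r/rc)^(κb/κc) = u
  generalize (r/(rb + rc) + 1)^(1 - κb/κc) = v
  have := mul_inv_cancel₀ hA.ne'
  linear_combination (2*M/r*(1 - r/rc)*(r/(rb + rc) + 1)*u*v) * this
end

section
/- For every r ∈ (r_b, r_c), the conformal factor of the metric in the Kruskal coordinates regular at the cosmological horizon satisfies the identity F(r)·exp(2κ_c·r_*(r)) = (2M/r)·(r/r_b − 1)^{1 + κ_c/κ_b}·(r/(r_b + r_c) + 1)^{2 − κ_c/κ_b}. -/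
/-- Conformal factor in the Kruskal coordinates regular at the cosmological horizon:
for `r ∈ (r_b, r_c)`,
`F(r)·exp(2κ_c r_*(r)) = (2M/r)(r/r_b − 1)^{1+κ_c/κ_b}(r/(r_b+r_c) + 1)^{2−κ_c/κ_b}`. -/
theorem stmt_11 (M Λ : ℝ) (hM : 0 < M) (hΛ : 0 < Λ)
    (F : ℝ → ℝ) (hF : ∀ r, F r = 1 - 2*M/r - Λ/3 * r^2)
    (rb rc : ℝ) (hrb : 0 < rb) (hbc : rb < rc)
    (hFb : F rb = 0) (hFc : F rc = 0)
    (κb κc : ℝ)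
    (hκb : κb = (rc - rb)*(rc + 2*rb)*Λ/(6*rb))
    (hκc : κc = (rc - rb)*(2*rc + rb)*Λ/(6*rc))
    (rstar : ℝ → ℝ)
    (hrstar : ∀ r, rstar r = 1/(2*κb) * Real.log (r/rb - 1)
      - 1/(2*κc) * Real.log (1 - r/rc)
      - (1/2)*(1/κb - 1/κc) * Real.log (r/(rb + rc) + 1)) :
    ∀ r ∈ Set.Ioo rb rc,
      F r * Real.exp (2*κc*rstar r) =
        2*M/r * (r/rb - 1) ^ ((1 + κc/κb : ℝ)) * (r/(rb + rc) + 1) ^ ((2 - κc/κb : ℝ)) := by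
  intro r hr
  obtain ⟨h1, h2⟩ := hr
  have hr0 : 0 < r := hrb.trans h1
  have hrc : 0 < rc := hrb.trans hbc
  have hd : 0 < rc - rb := sub_pos.mpr hbc
  have hκb0 : 0 < κb := by rw [hκb]; positivity
  have hκc0 : 0 < κc := by rw [hκc]; positivity
  have hA : 0 < r/rb - 1 := sub_pos.mpr ((one_lt_div hrb).mpr h1)
  have hB : 0 < 1 - r/rc := sub_pos.mpr ((div_lt_one hrc).mpr h2)
  have hC : 0 < r/(rb + rc) + 1 := by positivity
  have e1 : rb - 2*M - Λ/3*rb^3 = 0 := by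
    have h := hFb
    rw [hF] at h
    have : rb - 2*M - Λ/3*rb^3 = rb * (1 - 2*M/rb - Λ/3 * rb^2) := by
      field_simp
    rw [this, h, mul_zero]
  have e2 : rc - 2*M - Λ/3*rc^3 = 0 := by
    have h := hFc
    rw [hF] at h
    have : rc - 2*M - Λ/3*rc^3 = rc * (1 - 2*M/rc - Λ/3 * rc^2) := by
      field_simp
    rw [this, h, mul_zero]
  have e3 : 1 = Λ/3*(rb^2 + rb*rc + rc^2) := by
    apply mul_left_cancel₀ hd.ne'
    linear_combination e2 - e1
  have e4 : 2*M = Λ/3*(rb*rc*(rb+rc)) := by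
    linear_combination rb*e3 - e1
  have hFr : F r = 2*M/r * (r/rb - 1) * (1 - r/rc) * (r/(rb+rc) + 1) := by
    have h5 : 2*M/r * (r/rb - 1) * (1 - r/rc) * (r/(rb+rc) + 1)
        = Λ/3/r*((r-rb)*(rc-r)*(r+rb+rc)) := by
      rw [e4]; field_simp; ring
    have h6 : F r = (r - 2*M - Λ/3*r^3)/r := by
      rw [hF]; field_simp
    rw [h5, h6]
    linear_combination (1/r)*(r*e3 - e4)
  have hexp : 2*κc*rstar r = Real.log (r/rb - 1) * (κc/κb) - Real.log (1 - r/rc)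
      + Real.log (r/(rb+rc) + 1) * (1 - κc/κb) := by
    rw [hrstar]; field_simp; ring
  have h2' : (2 - κc/κb : ℝ) = 1 + (1 - κc/κb) := by ring
  rw [hexp, Real.exp_add, Real.exp_sub, Real.exp_log hB, ← Real.rpow_def_of_pos hA,
    ← Real.rpow_def_of_pos hC, hFr, h2', Real.rpow_add hA, Real.rpow_add hC,
    Real.rpow_one, Real.rpow_one]
  generalize (r/rb - 1) ^ (κc/κb) = X
  generalize (r/(rb+rc) + 1) ^ (1 - κc/κb) = Y
  generalize 1 - r/rc = B at hB
  have := hB.ne'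
  generalize r/rb - 1 = A
  generalize r/(rb+rc) + 1 = C
  field_simp
end

section
/- For all f, g ∈ C_c^∞(ℝ, ℂ), the limit lim_{ε→0⁺} −(1/π) ∫_ℝ ∫_ℝ conj(f(x))·g(y)·(x − y − iε)^{−2} dx dy exists and equals ∫_0^∞ conj(f̂(k))·ĝ(k)·2k dk. (This is the Fourier-space representation of the two-point function of the horizon state: the kernel −(1/π)(U₁ − U₂ − i0)^{−2} has positive-frequency Fourier content 2k on k ≥ 0.) -/
open MeasureTheory Filter

/-- unnormalised Fourier integral is a rescaled Schwartz function -/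
lemma aux_schwartz (f : ℝ → ℂ) (hf : ContDiff ℝ (⊤ : ℕ∞) f) (hfc : HasCompactSupport f) :
    ∃ F : SchwartzMap ℝ ℂ, ∀ k : ℝ, ∫ x : ℝ, Complex.exp (Complex.I * k * x) * f x
      = F ((-(1/(2*Real.pi))) * k) := by
  refine ⟨FourierTransform.fourier (hfc.toSchwartzMap hf), fun k => ?_⟩
  rw [SchwartzMap.fourier_coe, Real.fourier_real_eq_integral_exp_smul]
  refine integral_congr_ae (ae_of_all _ fun x => ?_)
  have : (Real.pi : ℂ) ≠ 0 := by exact_mod_cast Real.pi_ne_zero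
  simp only [smul_eq_mul]
  congr 2
  push_cast
  field_simp

lemma aux_int (ε : ℝ) (hε : 0 < ε) :
    Integrable (fun k : ℝ => (k : ℂ) * Complex.exp (-(ε * k))) (volume.restrict (Set.Ioi 0)) := by
  have h := integrableOn_rpow_mul_exp_neg_mul_rpow (p := 1) (s := 1) (b := ε)
    (by norm_num) (by norm_num) hε
  simp only [Real.rpow_one] at h
  have h' := h.ofReal (𝕜 := ℂ)
  refine h'.congr (ae_of_all _ fun k => ?_)
  simp

lemma aux_kernel (z : ℂ) (hz : 0 < z.re) :
    ∫ k in Set.Ioi (0:ℝ), (k : ℂ) * Complex.exp (-(z * k)) = (z ^ 2)⁻¹ := by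
  have hz0 : z ≠ 0 := by rintro rfl; simp at hz
  have hd : ∀ k ∈ Set.Ici (0:ℝ), HasDerivAt
      (fun k : ℝ => -(((k:ℂ) / z + 1 / z ^ 2) * Complex.exp (-(z * k))))
      ((k : ℂ) * Complex.exp (-(z * k))) k := by
    intro k _
    have h0 : HasDerivAt (fun k : ℝ => (k : ℂ)) 1 k := Complex.ofRealCLM.hasDerivAt
    have h1 := ((h0.const_mul z).neg).cexp
    have h2 := ((h0.div_const z).add_const (1 / z ^ 2)).mul h1
    refine h2.neg.congr_deriv ?_
    simp only [Pi.neg_apply]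
    generalize Complex.exp (-(z * k)) = E
    field_simp
    ring
  have hi : IntegrableOn (fun k : ℝ => (k : ℂ) * Complex.exp (-(z * k))) (Set.Ioi 0) := by
    refine (aux_int z.re hz).mono (Continuous.aestronglyMeasurable (by fun_prop))
      (ae_of_all _ fun k => ?_)
    simp [Complex.norm_exp]
  have ht : Tendsto (fun k : ℝ => -(((k:ℂ) / z + 1 / z ^ 2) * Complex.exp (-(z * k)))) atTop
      (nhds 0) := by
    have t1 : Tendsto (fun k : ℝ => (k:ℂ) * Complex.exp (-(z * k))) atTop (nhds 0) := by
      rw [tendsto_zero_iff_norm_tendsto_zero]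
      have := (tendsto_rpow_mul_exp_neg_mul_atTop_nhds_zero 1 z.re hz).norm
      simpa [Complex.norm_exp] using this
    have t2 : Tendsto (fun k : ℝ => Complex.exp (-(z * k))) atTop (nhds 0) := by
      rw [tendsto_zero_iff_norm_tendsto_zero]
      have := (tendsto_rpow_mul_exp_neg_mul_atTop_nhds_zero 0 z.re hz)
      simpa [Complex.norm_exp] using this
    have := ((t1.const_mul (1 / z)).add (t2.const_mul (1 / z ^ 2))).neg
    simp only [mul_zero, add_zero, neg_zero] at this
    refine this.congr fun k => ?_
    ring
  rw [integral_Ioi_of_hasDerivAt_of_tendsto' hd hi ht]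
  simp

lemma aux_main (f g : ℝ → ℂ) (hf : Continuous f) (hfi : Integrable f)
    (hg : Continuous g) (hgi : Integrable g) (A B : ℝ → ℂ) (hAc : Continuous A)
    (hB : ∀ k : ℝ, ∫ x : ℝ, Complex.exp (Complex.I * k * x) * f x = B k)
    (hA : ∀ k : ℝ, ∫ x : ℝ, Complex.exp (Complex.I * k * x) * g x = A k)
    (C : ℝ) (hC : ∀ k, ‖A k‖ ≤ C)
    (ε : ℝ) (hε : 0 < ε) :
    ∫ x : ℝ, ∫ y : ℝ,
      (starRingEnd ℂ) (f x) * g y * (((x : ℂ) - (y : ℂ) - (ε : ℂ) * Complex.I) ^ 2)⁻¹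
    = - ∫ k in Set.Ioi (0:ℝ), (starRingEnd ℂ) (B k) * A k * ((k:ℂ) * Complex.exp (-(ε * k))) := by
  have hw := aux_int ε hε
  have hnorm : ∀ k x : ℝ, ‖Complex.exp (Complex.I * k * x)‖ = 1 := by
    intro k x
    rw [Complex.norm_exp]; simp
  have hnorm' : ∀ k x : ℝ, ‖Complex.exp (-(Complex.I * k * x))‖ = 1 := by
    intro k x
    rw [Complex.norm_exp]; simp
  have step1 : ∀ x : ℝ, ∫ y : ℝ,
      (starRingEnd ℂ) (f x) * g y * (((x : ℂ) - (y : ℂ) - (ε : ℂ) * Complex.I) ^ 2)⁻¹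
      = - ∫ k in Set.Ioi (0:ℝ), (starRingEnd ℂ) (f x) * Complex.exp (-(Complex.I * k * x)) *
          (A k * ((k:ℂ) * Complex.exp (-(ε * k)))) := by
    intro x
    have e1 : ∀ y : ℝ, (starRingEnd ℂ) (f x) * g y * (((x : ℂ) - (y : ℂ) - (ε : ℂ) * Complex.I) ^ 2)⁻¹
       = - ∫ k in Set.Ioi (0:ℝ), (starRingEnd ℂ) (f x) * Complex.exp (-(Complex.I * k * x)) *
          (Complex.exp (Complex.I * k * y) * (g y * ((k:ℂ) * Complex.exp (-(ε * k))))) := by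
      intro y
      have hk := aux_kernel (ε + Complex.I * (x - y)) (by simp [hε])
      have : ((x : ℂ) - (y : ℂ) - (ε : ℂ) * Complex.I) ^ 2
          = - ((ε + Complex.I * (x - y)) ^ 2) := by
        linear_combination ((x:ℂ) - y)^2 * Complex.I_sq + (ε:ℂ)^2 * Complex.I_sq
      rw [this, inv_neg, ← hk, mul_neg, ← integral_const_mul]
      congr 1
      refine integral_congr_ae (ae_of_all _ fun k => ?_)
      have e : Complex.exp (-((ε + Complex.I * (x - y)) * k)) =
        Complex.exp (-(Complex.I * k * x)) * Complex.exp (Complex.I * k * y) * Complex.exp (-(ε * k)) := by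
        rw [← Complex.exp_add, ← Complex.exp_add]; congr 1; ring
      simp only [e]; ring
    simp_rw [e1]
    rw [integral_neg, integral_integral_swap]
    · congr 1
      refine integral_congr_ae (ae_of_all _ fun k => ?_)
      simp only
      rw [integral_const_mul, ← hA, ← integral_mul_const]
      congr 1
      refine integral_congr_ae (ae_of_all _ fun y => ?_)
      simp only
      ring
    · have := hgi.mul_prod hw
      have h2 := this.bdd_mul (c := ‖f x‖) (f := fun p : ℝ × ℝ => (starRingEnd ℂ) (f x) *
        Complex.exp (-(Complex.I * p.2 * x)) * Complex.exp (Complex.I * p.2 * p.1))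
        (Continuous.aestronglyMeasurable (by fun_prop))
        (ae_of_all _ fun p => by simp only [norm_mul, hnorm, hnorm', RCLike.norm_conj]; simp)
      refine h2.congr (ae_of_all _ fun p => ?_)
      simp only [Function.uncurry]; ring
  simp_rw [step1]
  rw [integral_neg, integral_integral_swap]
  · congr 1
    refine integral_congr_ae (ae_of_all _ fun k => ?_)
    simp only
    rw [integral_mul_const, ← hB, ← integral_conj, mul_assoc]
    congr 1
    refine integral_congr_ae (ae_of_all _ fun y => ?_)
    simp only [map_mul, ← Complex.exp_conj, Complex.conj_I, Complex.conj_ofReal]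
    rw [mul_comm]; congr 2; ring
  · have hfi' : Integrable (fun x => (starRingEnd ℂ) (f x)) :=
      hfi.mono (Continuous.aestronglyMeasurable (by fun_prop)) (ae_of_all _ fun x => by simp)
    have := hfi'.mul_prod hw
    have h2 := this.bdd_mul (c := C) (f := fun p : ℝ × ℝ => 
        Complex.exp (-(Complex.I * p.2 * p.1)) * A p.2)
        (Continuous.aestronglyMeasurable (by fun_prop))
        (ae_of_all _ fun p => by simp only [norm_mul, hnorm']; simpa using hC _)
    refine h2.congr (ae_of_all _ fun p => ?_)
    simp only [Function.uncurry]; ring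

/-- Fourier-space representation of the horizon two-point function: for smooth
compactly supported `f, g`,
`lim_{ε→0⁺} −(1/π) ∫∫ conj(f(x)) g(y) (x − y − iε)^{−2} dx dy
  = ∫_0^∞ conj(f̂(k)) ĝ(k) 2k dk`. -/
theorem stmt_14
    (f g : ℝ → ℂ) (hf : ContDiff ℝ (⊤ : ℕ∞) f) (hfc : HasCompactSupport f)
    (hg : ContDiff ℝ (⊤ : ℕ∞) g) (hgc : HasCompactSupport g)
    (fhat ghat : ℝ → ℂ)
    (hfhat : ∀ k : ℝ, fhat k =
      (((2*Real.pi) ^ (-(1/2) : ℝ) : ℝ) : ℂ) * ∫ x : ℝ, Complex.exp (Complex.I * k * x) * f x)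
    (hghat : ∀ k : ℝ, ghat k =
      (((2*Real.pi) ^ (-(1/2) : ℝ) : ℝ) : ℂ) * ∫ x : ℝ, Complex.exp (Complex.I * k * x) * g x) :
    Tendsto (fun ε : ℝ =>
        -(1/(Real.pi : ℂ)) * ∫ x : ℝ, ∫ y : ℝ,
          (starRingEnd ℂ) (f x) * g y * (((x : ℂ) - (y : ℂ) - (ε : ℂ) * Complex.I) ^ 2)⁻¹)
      (nhdsWithin 0 (Set.Ioi 0))
      (nhds (∫ k in Set.Ioi (0:ℝ), (starRingEnd ℂ) (fhat k) * ghat k * ((2*k : ℝ) : ℂ))) := by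

  have hfi : Integrable f := hf.continuous.integrable_of_hasCompactSupport hfc
  have hgi : Integrable g := hg.continuous.integrable_of_hasCompactSupport hgc
  obtain ⟨F, hF⟩ := aux_schwartz f hf hfc
  obtain ⟨G, hG⟩ := aux_schwartz g hg hgc
  set r : ℝ := -(1/(2*Real.pi)) with hr
  have hr0 : r ≠ 0 := by
    rw [hr]; have := Real.pi_pos; exact neg_ne_zero.mpr (by positivity)
  obtain ⟨C, -, hC⟩ := G.decay 0 0
  obtain ⟨D, -, hD⟩ := F.decay 1 0
  simp only [pow_zero, one_mul, norm_iteratedFDeriv_zero, pow_one] at hC hD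
  have hFc : Continuous fun k : ℝ => F (r * k) := F.continuous.comp (by fun_prop)
  have hGc : Continuous fun k : ℝ => G (r * k) := G.continuous.comp (by fun_prop)
  set c : ℂ := (((2*Real.pi) ^ (-(1/2) : ℝ) : ℝ) : ℂ) with hc
  have hcc : (starRingEnd ℂ) c * c = 1 / (2 * Real.pi) := by
    rw [hc, Complex.conj_ofReal, ← Complex.ofReal_mul, ← Real.rpow_add (by positivity)]
    norm_num [Real.rpow_neg_one]
  have hpi : (Real.pi : ℂ) ≠ 0 := by exact_mod_cast Real.pi_ne_zero
  have hH : Integrable (fun k : ℝ => (starRingEnd ℂ) (fhat k) * ghat k * ((2*k : ℝ) : ℂ)) := by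
    have h1 : Integrable (fun k : ℝ => G (r * k)) := G.integrable.comp_mul_left' hr0
    have h2 := h1.bdd_mul (c := D) (f := fun k : ℝ => (starRingEnd ℂ) (F (r * k)) * ((r * k : ℝ) : ℂ))
      (Continuous.aestronglyMeasurable (by fun_prop))
      (ae_of_all _ fun k => by
        rw [norm_mul, RCLike.norm_conj, Complex.norm_real, mul_comm]; exact hD _)
    have h3 := h2.const_mul ((starRingEnd ℂ) c * c * 2 / r)
    refine h3.congr (ae_of_all _ fun k => ?_)
    have : (r : ℂ) ≠ 0 := by exact_mod_cast hr0
    simp only [hfhat, hghat, hF, hG, map_mul]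
    push_cast
    field_simp
  have key : ∀ ε : ℝ, 0 < ε → -(1/(Real.pi : ℂ)) * ∫ x : ℝ, ∫ y : ℝ,
          (starRingEnd ℂ) (f x) * g y * (((x : ℂ) - (y : ℂ) - (ε : ℂ) * Complex.I) ^ 2)⁻¹
      = ∫ k in Set.Ioi (0:ℝ), Complex.exp (-(ε * k)) *
        ((starRingEnd ℂ) (fhat k) * ghat k * ((2*k : ℝ) : ℂ)) := by
    intro ε hε
    rw [aux_main f g hf.continuous hfi hg.continuous hgi _ _ hGc hF hG C (fun k => hC _) ε hε,
      neg_mul_neg, ← integral_const_mul]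
    refine integral_congr_ae (ae_of_all _ fun k => ?_)
    simp only [hfhat, hghat, hF, hG, map_mul]
    have : (1 / (Real.pi : ℂ)) = 2 * ((starRingEnd ℂ) c * c) := by rw [hcc]; field_simp
    rw [this]
    push_cast
    ring
  refine Tendsto.congr' (f₁ := fun ε : ℝ => ∫ k in Set.Ioi (0:ℝ), Complex.exp (-(ε * k)) *
        ((starRingEnd ℂ) (fhat k) * ghat k * ((2*k : ℝ) : ℂ))) ?_ ?_
  · filter_upwards [self_mem_nhdsWithin] with ε hε using (key ε hε).symm
  · refine tendsto_integral_filter_of_dominated_convergence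
      (fun k => ‖(starRingEnd ℂ) (fhat k) * ghat k * ((2*k : ℝ) : ℂ)‖) ?_ ?_ hH.restrict.norm ?_
    · refine Eventually.of_forall fun ε => ?_
      exact (Continuous.aestronglyMeasurable (by fun_prop)).mul hH.restrict.aestronglyMeasurable
    · filter_upwards [self_mem_nhdsWithin] with ε hε
      filter_upwards [ae_restrict_mem measurableSet_Ioi] with k hk
      rw [norm_mul]
      refine mul_le_of_le_one_left (norm_nonneg _) ?_
      rw [Complex.norm_exp]
      have : 0 < ε * k := mul_pos hε hk
      simp
      exact this.le
    · refine ae_of_all _ fun k => ?_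
      have h : Continuous fun ε : ℝ => Complex.exp (-(ε * k)) *
        ((starRingEnd ℂ) (fhat k) * ghat k * ((2*k : ℝ) : ℂ)) := by fun_prop
      have h' := (h.tendsto 0).mono_left (nhdsWithin_le_nhds (s := Set.Ioi (0:ℝ)))
      simpa using h'
end

section
/- Let κ > 0 and let k be a nonzero real number. Then lim_{ε→0⁺} ∫_ℝ e^{ikz}·(sinh(κ(z − iε)/2))^{−2} dz = −(8πk/κ²)·e^{πk/κ}/(e^{πk/κ} − e^{−πk/κ}). (This is the Fourier transform of the restriction of the two-point kernel to one horizon wedge expressed in the Killing coordinate u, and it exhibits the thermal factor (1 − e^{−2πk/κ})^{−1}.) -/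
open MeasureTheory Filter

/-- The integrand as a function of a complex variable. -/
noncomputable def kerG (κ k : ℝ) (w : ℂ) : ℂ :=
  Complex.exp (Complex.I * k * w) * ((Complex.sinh ((κ : ℂ) * w / 2)) ^ 2)⁻¹

lemma norm_sinh_sq (a b : ℝ) :
    ‖Complex.sinh ((a : ℂ) + b * Complex.I)‖ ^ 2 = Real.sinh a ^ 2 + Real.sin b ^ 2 := by
  rw [Complex.sinh_add, Complex.sinh_mul_I, Complex.cosh_mul_I, ← Complex.normSq_eq_norm_sq,
    ← Complex.ofReal_sinh, ← Complex.ofReal_cosh, ← Complex.ofReal_sin, ← Complex.ofReal_cos,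
    Complex.normSq_apply]
  simp [-Complex.ofReal_sinh, -Complex.ofReal_cosh, -Complex.ofReal_sin, -Complex.ofReal_cos]
  have h1 := Real.cosh_sq a
  have h2 := Real.sin_sq_add_cos_sq b
  have h3 : Real.cos b ^ 2 = 1 - Real.sin b ^ 2 := by linarith
  calc _ = Real.sinh a ^ 2 * Real.cos b ^ 2 + Real.cosh a ^ 2 * Real.sin b ^ 2 := by ring
    _ = _ := by rw [h1, h3]; ring

lemma sq_le_sinh_sq (a : ℝ) : a ^ 2 ≤ Real.sinh a ^ 2 := by
  rcases le_total 0 a with h | h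
  · have := Real.self_le_sinh_iff.mpr h
    gcongr
  · have := Real.self_le_sinh_iff.mpr (neg_nonneg.mpr h)
    rw [Real.sinh_neg] at this
    nlinarith

lemma norm_sinh_lower (κ x y s : ℝ) (hs0 : 0 < s) (hs : s ≤ Real.sin (κ * y / 2) ^ 2) :
    s * (1 + (κ * x / 2) ^ 2) ≤
      ‖Complex.sinh ((κ : ℂ) * ((x : ℂ) + y * Complex.I) / 2)‖ ^ 2 := by
  have e : (κ : ℂ) * ((x : ℂ) + y * Complex.I) / 2
      = ((κ * x / 2 : ℝ) : ℂ) + ((κ * y / 2 : ℝ) : ℂ) * Complex.I := by push_cast; ring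
  rw [e, norm_sinh_sq]
  have h1 := sq_le_sinh_sq (κ * x / 2)
  have h2 := Real.sin_sq_le_one (κ * y / 2)
  have h3 : 0 ≤ (κ * x / 2) ^ 2 := sq_nonneg _
  nlinarith

lemma norm_kerG_le (κ k x y s : ℝ) (hs0 : 0 < s) (hs : s ≤ Real.sin (κ * y / 2) ^ 2) :
    ‖kerG κ k ((x : ℂ) + y * Complex.I)‖ ≤
      Real.exp (-(k * y)) * s⁻¹ * (1 + (κ * x / 2) ^ 2)⁻¹ := by
  rw [kerG, norm_mul, norm_inv, norm_pow, Complex.norm_exp,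
    mul_assoc (Real.exp (-(k * y))), ← mul_inv]
  have h := norm_sinh_lower κ x y s hs0 hs
  have e : (Complex.I * k * ((x : ℂ) + y * Complex.I)).re = -(k * y) := by simp
  rw [e]
  gcongr

lemma sinh_ne (κ x y s : ℝ) (hs0 : 0 < s) (hs : s ≤ Real.sin (κ * y / 2) ^ 2) :
    Complex.sinh ((κ : ℂ) * ((x : ℂ) + y * Complex.I) / 2) ≠ 0 := by
  intro h0
  have h := norm_sinh_lower κ x y s hs0 hs
  rw [h0] at h
  simp at h
  have : 0 < s * (1 + (κ * x / 2) ^ 2) := by positivity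
  linarith

lemma integrable_kerG (κ k y s : ℝ) (hκ : 0 < κ) (hs0 : 0 < s)
    (hs : s ≤ Real.sin (κ * y / 2) ^ 2) :
    Integrable (fun x : ℝ => kerG κ k ((x : ℂ) + y * Complex.I)) := by
  have hb : Integrable (fun x : ℝ =>
      Real.exp (-(k * y)) * s⁻¹ * (1 + (κ * x / 2) ^ 2)⁻¹) := by
    have := (integrable_inv_one_add_sq.comp_mul_left' (R := κ / 2) (by positivity)).const_mul
      (Real.exp (-(k * y)) * s⁻¹)
    refine this.congr (Eventually.of_forall fun x => ?_)
    simp only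
    congr 4
    ring
  refine hb.mono' (Continuous.aestronglyMeasurable ?_)
    (Eventually.of_forall fun x => norm_kerG_le κ k x y s hs0 hs)
  unfold kerG
  refine Continuous.mul (by fun_prop) (Continuous.inv₀ (by fun_prop) fun x => ?_)
  exact pow_ne_zero _ (sinh_ne κ x y s hs0 hs)

lemma shift_kerG (κ k ε : ℝ) (hκ : 0 < κ) (hε : 0 < ε) (hε' : ε < Real.pi / κ) :
    ∫ x : ℝ, kerG κ k ((x : ℂ) + (-ε : ℝ) * Complex.I)
      = ∫ x : ℝ, kerG κ k ((x : ℂ) + (-(Real.pi / κ) : ℝ) * Complex.I) := by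
  set b := Real.pi / κ with hb
  have hκb : κ * b = Real.pi := by rw [hb]; field_simp
  set s := Real.sin (κ * ε / 2) ^ 2 with hs
  have hε2 : κ * ε < Real.pi := by rw [← hκb]; gcongr
  have hκε : 0 < κ * ε := by positivity
  have hsin : 0 < Real.sin (κ * ε / 2) :=
    Real.sin_pos_of_pos_of_lt_pi (by linarith) (by linarith)
  have hs0 : 0 < s := by positivity
  have hsy : ∀ y, -b ≤ y → y ≤ -ε → s ≤ Real.sin (κ * y / 2) ^ 2 := by
    intro y h1 h2
    have e : Real.sin (κ * y / 2) ^ 2 = Real.sin (κ * (-y) / 2) ^ 2 := by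
      rw [show κ * (-y) / 2 = -(κ * y / 2) by ring, Real.sin_neg]; ring
    rw [e, hs]
    have h3 : κ * (-y) ≤ Real.pi := by rw [← hκb]; gcongr; linarith
    have h4 : κ * ε ≤ κ * (-y) := by gcongr; linarith
    have := Real.sin_le_sin_of_le_of_le_pi_div_two (x := κ * ε / 2) (y := κ * (-y) / 2)
      (by linarith) (by linarith) (by linarith)
    gcongr
  have hrect : ∀ T : ℝ,
      (∫ x : ℝ in (-T)..T, kerG κ k ((x : ℂ) + (-b : ℝ) * Complex.I))
      - (∫ x : ℝ in (-T)..T, kerG κ k ((x : ℂ) + (-ε : ℝ) * Complex.I))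
      + Complex.I • (∫ y : ℝ in (-b)..(-ε), kerG κ k ((T : ℂ) + y * Complex.I))
      - Complex.I • (∫ y : ℝ in (-b)..(-ε), kerG κ k (((-T : ℝ) : ℂ) + y * Complex.I)) = 0 := by
    intro T
    refine Complex.integral_boundary_rect_eq_zero_of_differentiableOn (kerG κ k)
      ⟨-T, -b⟩ ⟨T, -ε⟩ ?_
    intro w hw
    have hw2 : w.im ∈ Set.uIcc (-b) (-ε) := hw.2
    rw [Set.uIcc_of_le (by linarith)] at hw2
    have hne := sinh_ne κ w.re w.im s hs0 (hsy _ hw2.1 hw2.2)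
    rw [Complex.re_add_im] at hne
    refine DifferentiableAt.differentiableWithinAt ?_
    unfold kerG
    refine DifferentiableAt.mul (by fun_prop) (DifferentiableAt.inv (by fun_prop) ?_)
    exact pow_ne_zero _ hne
  have hbd : Tendsto (fun T : ℝ => Real.exp (|k| * b) * s⁻¹ * (1 + (κ * T / 2) ^ 2)⁻¹
      * |(-ε) - (-b)|) atTop (nhds 0) := by
    have h1 : Tendsto (fun T : ℝ => 1 + (κ * T / 2) ^ 2) atTop atTop := by
      refine tendsto_atTop_add_const_left _ _ ((tendsto_pow_atTop two_ne_zero).comp ?_)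
      exact (tendsto_id.const_mul_atTop hκ).atTop_div_const two_pos
    have := (h1.inv_tendsto_atTop.const_mul (Real.exp (|k| * b) * s⁻¹)).mul_const |(-ε) - (-b)|
    simpa using this
  have hvb : ∀ T : ℝ, ‖∫ y : ℝ in (-b)..(-ε), kerG κ k ((T : ℂ) + y * Complex.I)‖ ≤
      Real.exp (|k| * b) * s⁻¹ * (1 + (κ * T / 2) ^ 2)⁻¹ * |(-ε) - (-b)| := by
    intro T
    refine intervalIntegral.norm_integral_le_of_norm_le_const fun y hy => ?_
    rw [Set.uIoc_of_le (by linarith)] at hy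
    refine (norm_kerG_le κ k T y s hs0 (hsy _ hy.1.le hy.2)).trans ?_
    have : -(k * y) ≤ |k| * b := by
      calc -(k * y) ≤ |k * y| := neg_le_abs _
        _ = |k| * |y| := abs_mul _ _
        _ ≤ |k| * b := by
          gcongr
          rw [abs_le]
          constructor <;> linarith [hy.1, hy.2]
    gcongr
  have hv1 : Tendsto (fun T : ℝ => ∫ y : ℝ in (-b)..(-ε), kerG κ k ((T : ℂ) + y * Complex.I))
      atTop (nhds 0) := squeeze_zero_norm hvb hbd
  have hv2 : Tendsto (fun T : ℝ => ∫ y : ℝ in (-b)..(-ε),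
      kerG κ k (((-T : ℝ) : ℂ) + y * Complex.I)) atTop (nhds 0) := by
    refine squeeze_zero_norm (fun T => (hvb (-T)).trans_eq ?_) hbd
    congr 4
    ring
  have hA := intervalIntegral_tendsto_integral
    (integrable_kerG κ k (-b) s hκ hs0 (hsy _ le_rfl (by linarith)))
    tendsto_neg_atTop_atBot tendsto_id
  have hB := intervalIntegral_tendsto_integral
    (integrable_kerG κ k (-ε) s hκ hs0 (hsy _ (by linarith) le_rfl))
    tendsto_neg_atTop_atBot tendsto_id
  have hlim := ((hA.sub hB).add (hv1.const_smul Complex.I)).sub (hv2.const_smul Complex.I)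
  have hz := tendsto_nhds_unique hlim
    ((tendsto_const_nhds (x := (0 : ℂ))).congr fun T => (hrect T).symm)
  simp only [smul_zero, add_zero, sub_zero] at hz
  exact (sub_eq_zero.mp hz).symm

lemma sigmoid_prod (y : ℝ) :
    Real.sigmoid y * (1 - Real.sigmoid y) = (4 * Real.cosh (y / 2) ^ 2)⁻¹ := by
  rw [← Real.sigmoid_neg, Real.sigmoid_def, Real.sigmoid_def, ← mul_inv, Real.cosh_eq, neg_neg]
  congr 1
  have h1 : Real.exp y = Real.exp (y / 2) ^ 2 := by rw [← Real.exp_nat_mul]; congr 1; push_cast; ring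
  have h2 : Real.exp (-y) = Real.exp (-(y / 2)) ^ 2 := by
    rw [← Real.exp_nat_mul]; congr 1; push_cast; ring
  have h3 : Real.exp (y / 2) * Real.exp (-(y / 2)) = 1 := by rw [← Real.exp_add]; simp
  rw [h1, h2]
  linear_combination (Real.exp (y / 2) * Real.exp (-(y / 2)) - 1) * h3

lemma sigmoid_cpow (y : ℝ) (u : ℂ) :
    (Real.sigmoid y : ℂ) ^ u * (1 - (Real.sigmoid y : ℂ)) ^ (-u) = Complex.exp (u * y) := by
  have h0 := Real.sigmoid_pos y
  have h1 := Real.sigmoid_pos (-y)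
  have e : (1 - (Real.sigmoid y : ℂ)) = (Real.sigmoid (-y) : ℂ) := by
    rw [Real.sigmoid_neg]; push_cast; ring
  rw [e, Complex.cpow_def_of_ne_zero (by exact_mod_cast h0.ne'),
    Complex.cpow_def_of_ne_zero (by exact_mod_cast h1.ne'), ← Complex.exp_add,
    ← Complex.ofReal_log h0.le, ← Complex.ofReal_log h1.le]
  have hl : Real.log (Real.sigmoid (-y)) = Real.log (Real.sigmoid y) - y := by
    rw [← Real.sigmoid_mul_rexp_neg, Real.log_mul h0.ne' (Real.exp_pos _).ne', Real.log_exp]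
    ring
  rw [hl]
  congr 1
  push_cast
  ring

lemma beta_eq (κ k : ℝ) (hκ : 0 < κ) :
    Complex.betaIntegral (1 + Complex.I * (k / κ)) (1 - Complex.I * (k / κ)) =
      (κ / 4) * ∫ x : ℝ, Complex.exp (Complex.I * k * x) *
        ((Real.cosh (κ * x / 2) ^ 2 : ℝ) : ℂ)⁻¹ := by
  have himg : (fun x : ℝ => Real.sigmoid (κ * x)) '' Set.univ = Set.Ioo 0 1 := by
    rw [← Real.range_sigmoid, Set.image_univ]
    exact (mul_left_surjective₀ hκ.ne').range_comp Real.sigmoid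
  have hd : ∀ x ∈ (Set.univ : Set ℝ), HasDerivWithinAt (fun x : ℝ => Real.sigmoid (κ * x))
      (Real.sigmoid (κ * x) * (1 - Real.sigmoid (κ * x)) * κ) Set.univ x := by
    intro x _
    have h1 : HasDerivAt (fun x : ℝ => κ * x) κ x := by
      simpa using (hasDerivAt_id x).const_mul κ
    exact ((Real.hasDerivAt_sigmoid (κ * x)).comp x h1).hasDerivWithinAt
  have hinj : Set.InjOn (fun x : ℝ => Real.sigmoid (κ * x)) Set.univ := by
    intro a _ b _ h
    exact mul_left_cancel₀ hκ.ne' (Real.sigmoid_injective h)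
  have hcv := integral_image_eq_integral_abs_deriv_smul MeasurableSet.univ hd hinj
    (fun t : ℝ => (t : ℂ) ^ (1 + Complex.I * (k / κ) - 1 : ℂ) *
      (1 - (t : ℂ)) ^ (1 - Complex.I * (k / κ) - 1 : ℂ))
  rw [Complex.betaIntegral, intervalIntegral.integral_of_le zero_le_one,
    integral_Ioc_eq_integral_Ioo, ← himg, hcv, setIntegral_univ, ← integral_const_mul]
  refine integral_congr_ae (Eventually.of_forall fun x => ?_)
  have hκc : (κ : ℂ) ≠ 0 := by exact_mod_cast hκ.ne'
  simp only
  rw [sigmoid_prod, abs_of_pos (by have := Real.cosh_pos (κ * x / 2); positivity),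
    show (1 + Complex.I * (k / κ) - 1 : ℂ) = Complex.I * (k / κ) by ring,
    show (1 - Complex.I * (k / κ) - 1 : ℂ) = -(Complex.I * (k / κ)) by ring, sigmoid_cpow,
    show (Complex.I * (k / κ) * ((κ * x : ℝ) : ℂ)) = Complex.I * k * x by
      push_cast; field_simp, Complex.real_smul]
  push_cast
  rw [mul_inv]
  ring

lemma beta_val (s : ℝ) (hs : s ≠ 0) :
    Complex.betaIntegral (1 + Complex.I * s) (1 - Complex.I * s) =
      ((Real.pi * s / Real.sinh (Real.pi * s) : ℝ) : ℂ) := by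
  have h := Complex.Gamma_mul_Gamma_eq_betaIntegral (s := 1 + Complex.I * s)
    (t := 1 - Complex.I * s) (by simp) (by simp)
  have h2 : (1 + Complex.I * s + (1 - Complex.I * s) : ℂ) = 1 + 1 := by ring
  have hne : Complex.I * (s : ℂ) ≠ 0 := mul_ne_zero Complex.I_ne_zero (by exact_mod_cast hs)
  rw [h2, Complex.Gamma_add_one 1 one_ne_zero, Complex.Gamma_one, mul_one, one_mul] at h
  rw [← h, add_comm, Complex.Gamma_add_one _ hne, mul_assoc, Complex.Gamma_mul_Gamma_one_sub,
    show (Real.pi : ℂ) * (Complex.I * s) = ((Real.pi * s : ℝ) : ℂ) * Complex.I by push_cast; ring,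
    Complex.sin_mul_I, ← Complex.ofReal_sinh]
  have hsh : ((Real.sinh (Real.pi * s) : ℝ) : ℂ) ≠ 0 := by
    rw [Complex.ofReal_ne_zero]
    exact Real.sinh_ne_zero.mpr (mul_ne_zero Real.pi_ne_zero hs)
  rw [Complex.ofReal_div]
  push_cast [-Complex.ofReal_sinh]
  field_simp

lemma kerG_bottom (κ k : ℝ) (hκ : 0 < κ) (x : ℝ) :
    kerG κ k ((x : ℂ) + (-(Real.pi / κ) : ℝ) * Complex.I) =
      (-(Real.exp (Real.pi * k / κ) : ℂ)) * (Complex.exp (Complex.I * k * x) *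
        ((Real.cosh (κ * x / 2) ^ 2 : ℝ) : ℂ)⁻¹) := by
  have hκc : (κ : ℂ) ≠ 0 := by exact_mod_cast hκ.ne'
  have e1 : (κ : ℂ) * ((x : ℂ) + (-(Real.pi / κ) : ℝ) * Complex.I) / 2
      = ((κ * x / 2 : ℝ) : ℂ) + ((-(Real.pi / 2) : ℝ) : ℂ) * Complex.I := by
    push_cast; field_simp
  have e2 : Complex.I * k * ((x : ℂ) + (-(Real.pi / κ) : ℝ) * Complex.I)
      = ((Real.pi * k / κ : ℝ) : ℂ) + Complex.I * k * x := by
    push_cast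
    linear_combination (-(k * (Real.pi / κ)) : ℂ) * Complex.I_sq
  rw [kerG, e1, e2, Complex.exp_add, Complex.sinh_add, Complex.sinh_mul_I, Complex.cosh_mul_I,
    ← Complex.ofReal_cos, ← Complex.ofReal_sin, ← Complex.ofReal_sinh, ← Complex.ofReal_cosh,
    ← Complex.ofReal_exp, Real.cos_neg, Real.sin_neg, Real.cos_pi_div_two, Real.sin_pi_div_two]
  have e3 : (((Real.sinh (κ * x / 2) : ℝ) : ℂ) * ((0 : ℝ) : ℂ) +
      ((Real.cosh (κ * x / 2) : ℝ) : ℂ) * (((-1 : ℝ) : ℂ) * Complex.I)) ^ 2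
      = -((Real.cosh (κ * x / 2) ^ 2 : ℝ) : ℂ) := by
    rw [Complex.ofReal_pow, Complex.ofReal_zero, Complex.ofReal_neg, Complex.ofReal_one]
    linear_combination (((Real.cosh (κ * x / 2) : ℝ) : ℂ)) ^ 2 * Complex.I_sq
  rw [e3, inv_neg]
  ring

/-- Thermal Fourier transform of the wedge two-point kernel: for `κ > 0` and `k ≠ 0`,
`lim_{ε→0⁺} ∫ e^{ikz} (sinh(κ(z − iε)/2))^{−2} dz
  = −(8πk/κ²) e^{πk/κ}/(e^{πk/κ} − e^{−πk/κ})`. -/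
theorem stmt_16 (κ : ℝ) (hκ : 0 < κ) (k : ℝ) (hk : k ≠ 0) :
    Tendsto (fun ε : ℝ => ∫ z : ℝ,
        Complex.exp (Complex.I * k * z) *
          ((Complex.sinh ((κ : ℂ) * ((z : ℂ) - (ε : ℂ) * Complex.I) / 2)) ^ 2)⁻¹)
      (nhdsWithin 0 (Set.Ioi 0))
      (nhds (((-(8*Real.pi*k/κ^2) * Real.exp (Real.pi*k/κ) /
        (Real.exp (Real.pi*k/κ) - Real.exp (-(Real.pi*k/κ))) : ℝ) : ℂ))) := by
  set C : ℝ := -(8*Real.pi*k/κ^2) * Real.exp (Real.pi*k/κ) /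
        (Real.exp (Real.pi*k/κ) - Real.exp (-(Real.pi*k/κ))) with hC
  have hκc : (κ : ℂ) ≠ 0 := by exact_mod_cast hκ.ne'
  have hs : k / κ ≠ 0 := div_ne_zero hk hκ.ne'
  have hbot : ∫ x : ℝ, kerG κ k ((x : ℂ) + (-(Real.pi / κ) : ℝ) * Complex.I) = (C : ℂ) := by
    simp_rw [kerG_bottom κ k hκ]
    rw [integral_const_mul]
    have h1 := beta_eq κ k hκ
    have h2 := beta_val (k / κ) hs
    rw [Complex.ofReal_div, h1] at h2
    set J := ∫ x : ℝ, Complex.exp (Complex.I * k * x) *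
        ((Real.cosh (κ * x / 2) ^ 2 : ℝ) : ℂ)⁻¹
    have hJ : J = ((4 / κ * (Real.pi * (k / κ) / Real.sinh (Real.pi * (k / κ))) : ℝ) : ℂ) := by
      rw [Complex.ofReal_mul, ← h2]
      push_cast
      field_simp
    rw [hJ, ← Complex.ofReal_neg, ← Complex.ofReal_mul, hC]
    congr 1
    have hsh : Real.sinh (Real.pi * k / κ) ≠ 0 := by
      rw [mul_div_assoc]
      exact Real.sinh_ne_zero.mpr (mul_ne_zero Real.pi_ne_zero hs)
    have he : Real.exp (Real.pi*k/κ) - Real.exp (-(Real.pi*k/κ))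
        = 2 * Real.sinh (Real.pi * k / κ) := by rw [Real.sinh_eq]; ring
    rw [he, ← mul_div_assoc]
    field_simp
    ring
  have hev : ∀ᶠ ε : ℝ in nhdsWithin 0 (Set.Ioi 0),
      (Complex.exp (((-(k * ε) : ℝ) : ℂ)) * (C : ℂ)) = ∫ z : ℝ,
        Complex.exp (Complex.I * k * z) *
          ((Complex.sinh ((κ : ℂ) * ((z : ℂ) - (ε : ℂ) * Complex.I) / 2)) ^ 2)⁻¹ := by
    filter_upwards [Ioo_mem_nhdsGT (show (0 : ℝ) < Real.pi / κ by positivity)] with ε hε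
    rw [← hbot, ← shift_kerG κ k ε hκ hε.1 hε.2, ← integral_const_mul]
    refine integral_congr_ae (Eventually.of_forall fun x => ?_)
    simp only [kerG]
    rw [← mul_assoc, ← Complex.exp_add]
    congr 2
    · push_cast
      linear_combination (-(k * ε) : ℂ) * Complex.I_sq
    · push_cast
      ring_nf
  refine Tendsto.congr' hev ?_
  have hc : Continuous (fun ε : ℝ => Complex.exp (((-(k * ε) : ℝ) : ℂ)) * (C : ℂ)) := by fun_prop
  have := (hc.tendsto 0).mono_left (nhdsWithin_le_nhds (s := Set.Ioi 0))
  simpa using this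
end

section
/- Let κ > 0. For all f, g ∈ C_c^∞(ℝ, ℂ), the limit lim_{ε→0⁺} −(κ²/(4π)) ∫_ℝ ∫_ℝ conj(f(u))·g(v)·(sinh(κ(u − v − iε)/2))^{−2} du dv exists and equals ∫_ℝ conj(f̂(k))·ĝ(k)·(2k·e^{πk/κ}/(e^{πk/κ} − e^{−πk/κ})) dk, where the density 2k·e^{πk/κ}/(e^{πk/κ} − e^{−πk/κ}) is interpreted at k = 0 by its continuous extension κ/π. (This identifies the restriction of the horizon two-point function to one wedge, in the Killing coordinate u, with the integral against the thermal measure dμ(k).) -/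
open MeasureTheory Filter

noncomputable def wt (a k : ℝ) : ℝ := 2 * k / (1 - Real.exp (-(a * k)))

lemma wt_meas (a : ℝ) : Measurable (wt a) := by
  unfold wt
  fun_prop

lemma wt_neg (a k : ℝ) : wt a (-k) = wt a k * Real.exp (-(a * k)) := by
  unfold wt
  by_cases h : Real.exp (-(a*k)) = 1
  · have h2 : Real.exp (-(a * -k)) = 1 := by
      have : a * k = 0 := by simpa using h
      simp [this]
    rw [h, h2]; simp
  have h1 : Real.exp (-(a * -k)) = (Real.exp (-(a*k)))⁻¹ := by
    rw [← Real.exp_neg]; congr 1; ring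
  rw [h1]
  have hp := Real.exp_pos (-(a*k))
  set e := Real.exp (-(a*k))
  have : 1 - e ≠ 0 := sub_ne_zero.mpr (Ne.symm h)
  have h3 : 1 - e⁻¹ = -((1 - e) / e) := by field_simp; ring
  rw [h3]
  field_simp

lemma wt_nonneg_of_pos {a k : ℝ} (ha : 0 < a) (hk : 0 ≤ k) : 0 ≤ wt a k := by
  unfold wt
  have : Real.exp (-(a*k)) ≤ 1 := by
    rw [Real.exp_le_one_iff]; have := mul_nonneg ha.le hk; linarith
  exact div_nonneg (by linarith) (by linarith)

lemma wt_le_of_pos {a k : ℝ} (ha : 0 < a) (hk : 0 ≤ k) : wt a k ≤ 2 / a + 2 * k := by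
  rcases hk.eq_or_lt with rfl | hk
  · simp [wt]; positivity
  unfold wt
  have hak := mul_pos ha hk
  have h1 : Real.exp (-(a*k)) < 1 := by
    rw [Real.exp_lt_one_iff]; linarith
  rw [div_le_iff₀ (by linarith)]
  have h2 : (1 + a * k) * Real.exp (-(a*k)) ≤ 1 := by
    have := Real.add_one_le_exp (a*k)
    calc (1 + a * k) * Real.exp (-(a*k)) ≤ Real.exp (a*k) * Real.exp (-(a*k)) := by
          gcongr; linarith
      _ = 1 := by rw [← Real.exp_add]; simp
  have h3 : 2 / a + 2 * k = 2 / a * (1 + a * k) := by field_simp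
  rw [h3, mul_assoc]
  have h4 : a * k ≤ (1 + a * k) * (1 - Real.exp (-(a*k))) := by nlinarith
  calc 2 * k = 2 / a * (a * k) := by field_simp
    _ ≤ _ := by gcongr

lemma wt_nonneg {a : ℝ} (ha : 0 < a) (k : ℝ) : 0 ≤ wt a k := by
  rcases le_total 0 k with h | h
  · exact wt_nonneg_of_pos ha h
  · have := wt_neg a (-k)
    rw [neg_neg] at this
    rw [this]
    have := wt_nonneg_of_pos ha (neg_nonneg.mpr h)
    positivity

lemma wt_bound {a ε : ℝ} (ha : 0 < a) (h0 : 0 ≤ ε) (h1 : ε ≤ a) (k : ℝ) :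
    wt a k * Real.exp (-(k * ε)) ≤ 2 / a + 2 * |k| := by
  rcases le_total 0 k with h | h
  · rw [abs_of_nonneg h]
    have h2 : Real.exp (-(k*ε)) ≤ 1 := by
      rw [Real.exp_le_one_iff]; have := mul_nonneg h h0; linarith
    calc _ ≤ wt a k * 1 := mul_le_mul_of_nonneg_left h2 (wt_nonneg ha k)
      _ ≤ _ := by rw [mul_one]; exact wt_le_of_pos ha h
  · rw [abs_of_nonpos h]
    have := wt_neg a (-k)
    rw [neg_neg] at this
    rw [this, mul_assoc, ← Real.exp_add]
    have h2 : Real.exp (-(a * -k) + -(k*ε)) ≤ 1 := by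
      rw [Real.exp_le_one_iff]; nlinarith
    calc _ ≤ wt a (-k) * 1 := mul_le_mul_of_nonneg_left h2 (wt_nonneg ha _)
      _ ≤ _ := by rw [mul_one]; exact wt_le_of_pos ha (by linarith)

lemma int_k_exp_real {r : ℝ} (hr : 0 < r) :
    IntegrableOn (fun k : ℝ => k * Real.exp (-(k * r))) (Set.Ioi 0) := by
  have := integrableOn_rpow_mul_exp_neg_mul_rpow (p := 1) (s := 1) (by norm_num) one_pos hr
  refine this.congr_fun (fun x hx => ?_) measurableSet_Ioi
  simp only [Real.rpow_one]; ring_nf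

lemma integral_k_exp_real {r : ℝ} (hr : 0 < r) :
    ∫ k in Set.Ioi (0:ℝ), k * Real.exp (-(k * r)) = 1 / r ^ 2 := by
  have := Real.integral_rpow_mul_exp_neg_mul_Ioi (a := 2) two_pos hr
  have h2 : Real.Gamma 2 = 1 := Real.Gamma_two
  rw [h2] at this
  rw [mul_one] at this
  rw [show (1 / r) ^ (2:ℝ) = 1 / r^2 by simp] at this
  rw [← this]
  refine setIntegral_congr_fun measurableSet_Ioi (fun x hx => ?_)
  norm_num [mul_comm]

lemma norm_k_exp {s : ℂ} {k : ℝ} : ‖Complex.exp (-(k * s))‖ = Real.exp (-(k * s.re)) := by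
  rw [Complex.norm_exp]; simp

lemma int_k_exp {s : ℂ} (hs : 0 < s.re) :
    IntegrableOn (fun k : ℝ => (k : ℂ) * Complex.exp (-(k * s))) (Set.Ioi 0) := by
  refine (int_k_exp_real hs).mono' (by fun_prop) ?_
  refine (ae_restrict_iff' measurableSet_Ioi).mpr (.of_forall fun k hk => ?_)
  rw [norm_mul, norm_k_exp, Complex.norm_real, Real.norm_of_nonneg (le_of_lt hk)]

lemma integral_k_exp {s : ℂ} (hs : 0 < s.re) :
    ∫ k in Set.Ioi (0:ℝ), (k : ℂ) * Complex.exp (-(k * s)) = 1 / s ^ 2 := by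
  have hs0 : s ≠ 0 := by rintro rfl; simp at hs
  have key := integral_Ioi_of_hasDerivAt_of_tendsto' (a := 0)
    (f := fun k : ℝ => -((k : ℂ) / s + 1 / s ^ 2) * Complex.exp (-(k * s)))
    (f' := fun k : ℝ => (k : ℂ) * Complex.exp (-(k * s))) (m := 0) ?_ (int_k_exp hs) ?_
  · rw [key]; simp
  · intro x _
    have h1 : HasDerivAt (fun z : ℂ => -(z / s + 1 / s ^ 2) * Complex.exp (-(z * s)))
      (x * Complex.exp (-(x * s))) (x : ℂ) := by
      have e1 : HasDerivAt (fun z : ℂ => -(z / s + 1 / s ^ 2)) (-(1 / s)) (x : ℂ) :=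
        (((hasDerivAt_id (x:ℂ)).div_const s).add_const _).neg
      have e2 : HasDerivAt (fun z : ℂ => Complex.exp (-(z * s)))
        (Complex.exp (-(x * s)) * (-(1 * s))) (x : ℂ) :=
        (((hasDerivAt_id (x:ℂ)).mul_const s).neg).cexp
      refine (e1.mul e2).congr_deriv ?_
      field_simp
      ring
    exact h1.comp_ofReal
  · rw [tendsto_zero_iff_norm_tendsto_zero]
    have t1 := tendsto_rpow_mul_exp_neg_mul_atTop_nhds_zero 1 s.re hs
    have t0 := tendsto_rpow_mul_exp_neg_mul_atTop_nhds_zero 0 s.re hs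
    have t := (t1.const_mul (1 / ‖s‖)).add (t0.const_mul (1 / ‖s‖^2))
    simp only [mul_zero, add_zero] at t
    refine squeeze_zero' (.of_forall fun _ => norm_nonneg _) ?_ t
    filter_upwards [eventually_ge_atTop 0] with k hk
    rw [norm_mul, norm_k_exp, norm_neg]
    have : ‖(k:ℂ) / s + 1 / s ^ 2‖ ≤ k / ‖s‖ + 1 / ‖s‖^2 := by
      refine (norm_add_le _ _).trans ?_
      simp [abs_of_nonneg hk]
    calc _ ≤ (k / ‖s‖ + 1 / ‖s‖^2) * Real.exp (-(k * s.re)) := by gcongr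
      _ = _ := by
        rw [show -(k * s.re) = -s.re * k by ring]
        simp
        ring

lemma wt_int {a : ℝ} (ha : 0 < a) {s : ℂ} (hs : 0 < s.re) :
    IntegrableOn (fun k : ℝ => (wt a k : ℂ) * Complex.exp (-(k * s))) (Set.Ioi 0) := by
  have i0 : IntegrableOn (fun k : ℝ => Real.exp (-s.re * k)) (Set.Ioi 0) :=
    exp_neg_integrableOn_Ioi 0 hs
  have := (i0.const_mul (2/a)).add ((int_k_exp_real hs).const_mul 2)
  refine this.mono' ?_ ?_
  · exact ((Complex.measurable_ofReal.comp (wt_meas a)).mul (by fun_prop)).aestronglyMeasurable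
  refine (ae_restrict_iff' measurableSet_Ioi).mpr (.of_forall fun k hk => ?_)
  rw [norm_mul, norm_k_exp, Complex.norm_real, Real.norm_of_nonneg (wt_nonneg ha k)]
  have := wt_le_of_pos ha (le_of_lt hk)
  calc _ ≤ (2/a + 2 * k) * Real.exp (-(k * s.re)) := by gcongr
    _ = _ := by
      simp only [Pi.add_apply]
      rw [show -(k * s.re) = -s.re * k by ring]; ring

lemma wt_hasSum {a : ℝ} (ha : 0 < a) {s : ℂ} (hs : 0 < s.re) :
    HasSum (fun n : ℕ => 2 / (s + n * a) ^ 2)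
      (∫ k in Set.Ioi (0:ℝ), (wt a k : ℂ) * Complex.exp (-(k * s))) := by
  have hre : ∀ n : ℕ, 0 < (s + n * a).re := by
    intro n
    have : (s + n * a).re = s.re + n * a := by simp
    rw [this]; positivity
  have key := hasSum_integral_of_summable_integral_norm (μ := volume.restrict (Set.Ioi (0:ℝ)))
    (F := fun (n : ℕ) (k : ℝ) => 2 * ((k : ℂ) * Complex.exp (-(k * (s + n * a)))))
    (fun n => (int_k_exp (hre n)).const_mul 2) ?_
  · have E : (∫ k in Set.Ioi (0:ℝ), (wt a k : ℂ) * Complex.exp (-(k * s))) =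
        ∫ k in Set.Ioi (0:ℝ), ∑' n : ℕ, 2 * ((k : ℂ) * Complex.exp (-(k * (s + n * a)))) := by
      refine setIntegral_congr_fun measurableSet_Ioi (fun k hk => ?_)
      have hk : 0 < k := hk
      have hlt : Real.exp (-(a*k)) < 1 := by
        rw [Real.exp_lt_one_iff]; have := mul_pos ha hk; linarith
      have hg : HasSum (fun n : ℕ => (Complex.exp (-(a*k)))^n) (1 - Complex.exp (-(a*k)))⁻¹ := by
        apply hasSum_geometric_of_norm_lt_one
        rw [Complex.norm_exp]; simpa using mul_pos ha hk
      have := (hg.mul_left (2 * (k:ℂ) * Complex.exp (-(k*s)))).tsum_eq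
      have e : ∀ n : ℕ, 2 * ((k : ℂ) * Complex.exp (-(k * (s + n * a))))
        = 2 * (k:ℂ) * Complex.exp (-(k*s)) * (Complex.exp (-(a*k)))^n := by
        intro n
        rw [← Complex.exp_nat_mul, mul_assoc, mul_assoc, ← Complex.exp_add]
        congr 3; ring
      simp_rw [e]
      rw [this]
      unfold wt
      push_cast
      ring
    rw [E]
    refine key.congr_fun ?_
    intro n
    rw [integral_const_mul, integral_k_exp (hre n)]; ring
  · have e : ∀ n : ℕ, ∫ k in Set.Ioi (0:ℝ), ‖2 * ((k : ℂ) * Complex.exp (-(k * (s + n * a))))‖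
      = 2 * (1 / (s.re + n * a)^2) := by
      intro n
      have : (s + n * a).re = s.re + n * a := by simp
      rw [← this, ← integral_k_exp_real (hre n), ← integral_const_mul]
      refine setIntegral_congr_fun measurableSet_Ioi (fun k hk => ?_)
      have hk : 0 < k := hk
      rw [norm_mul, norm_mul, norm_k_exp, Complex.norm_real, Real.norm_of_nonneg hk.le]
      simp
    simp_rw [e]
    apply Summable.mul_left
    have := (Real.summable_one_div_nat_add_rpow (s.re / a) 2).mpr (by norm_num)
    refine (this.mul_left (1/a^2)).congr fun n => ?_
    have h1 : 0 < (n:ℝ) + s.re / a := by positivity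
    rw [abs_of_pos h1]
    have : s.re + n * a = a * (n + s.re / a) := by field_simp; ring
    rw [this]
    simp [mul_pow]
    ring

lemma wt_refl {a : ℝ} (s : ℂ) (k : ℝ) :
    (wt a (-k) : ℂ) * Complex.exp (-(((-k : ℝ) : ℂ) * s)) =
      (wt a k : ℂ) * Complex.exp (-(k * (a - s))) := by
  rw [wt_neg]
  push_cast
  rw [mul_assoc, ← Complex.exp_add]
  congr 2; ring

lemma wt_int_Iio {a : ℝ} (ha : 0 < a) {s : ℂ} (hs : s.re < a) :
    IntegrableOn (fun k : ℝ => (wt a k : ℂ) * Complex.exp (-(k * s))) (Set.Iio 0) := by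
  have h := wt_int ha (s := a - s) (by simpa using hs)
  have := (Measure.measurePreserving_neg (volume : Measure ℝ)).integrableOn_comp_preimage
    (Homeomorph.neg ℝ).measurableEmbedding
    (f := fun k : ℝ => (wt a k : ℂ) * Complex.exp (-(k * s))) (s := Set.Iio 0)
  rw [← this]
  have e : (Neg.neg : ℝ → ℝ) ⁻¹' Set.Iio 0 = Set.Ioi 0 := by ext; simp
  rw [e]
  refine h.congr_fun (fun k _ => ?_) measurableSet_Ioi
  exact (wt_refl s k).symm

lemma wt_integrable {a : ℝ} (ha : 0 < a) {s : ℂ} (h0 : 0 < s.re) (hs : s.re < a) :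
    Integrable (fun k : ℝ => (wt a k : ℂ) * Complex.exp (-(k * s))) := by
  rw [← integrableOn_univ, ← Set.Iic_union_Ioi (a := (0:ℝ))]
  exact ((integrableOn_Iic_iff_integrableOn_Iio).mpr (wt_int_Iio ha hs)).union (wt_int ha h0)

lemma wt_hasSum_int {a : ℝ} (ha : 0 < a) {s : ℂ} (h0 : 0 < s.re) (hs : s.re < a) :
    HasSum (fun n : ℤ => 2 / (s + n * a) ^ 2)
      (∫ k : ℝ, (wt a k : ℂ) * Complex.exp (-(k * s))) := by
  have h1 := wt_hasSum ha h0
  have h2 := wt_hasSum ha (s := a - s) (by simpa using hs)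
  have e : (∫ k : ℝ, (wt a k : ℂ) * Complex.exp (-(k * s))) =
      (∫ k in Set.Ioi (0:ℝ), (wt a k : ℂ) * Complex.exp (-(k * s))) +
      (∫ k in Set.Ioi (0:ℝ), (wt a k : ℂ) * Complex.exp (-(k * (a - s)))) := by
    rw [← intervalIntegral.integral_Iic_add_Ioi (b := 0)
      ((integrableOn_Iic_iff_integrableOn_Iio).mpr (wt_int_Iio ha hs)) (wt_int ha h0), add_comm]
    congr 1
    have := integral_comp_neg_Ioi 0 (fun k : ℝ => (wt a k : ℂ) * Complex.exp (-(k * s)))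
    rw [neg_zero] at this
    rw [← this]
    refine setIntegral_congr_fun measurableSet_Ioi (fun k _ => ?_)
    exact wt_refl s k
  rw [e]
  refine HasSum.of_nat_of_neg_add_one (f := fun n : ℤ => 2 / (s + n * a) ^ 2) (by simpa using h1) ?_
  refine h2.congr_fun fun n => ?_
  push_cast
  congr 1; ring

lemma sin_series_upper {z : ℂ} (hz : 0 < z.im) :
    ∑' n : ℤ, 1 / (z + n) ^ 2 = (Real.pi : ℂ) ^ 2 / Complex.sin (Real.pi * z) ^ 2 := by
  have h := iteratedDerivWithin_cot_pi_mul_eq_mul_tsum_div_pow (k := 1) le_rfl (z := z) hz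
  rw [iteratedDerivWithin_one, derivWithin_of_isOpen UpperHalfPlane.isOpen_upperHalfPlaneSet hz] at h
  have hs : Complex.sin (Real.pi * z) ≠ 0 :=
    sin_pi_mul_ne_zero (UpperHalfPlane.coe_mem_integerComplement ⟨z, hz⟩)
  have hd : HasDerivAt (fun x : ℂ => (Real.pi : ℂ) * Complex.cot (Real.pi * x))
      (-((Real.pi : ℂ) ^ 2 / Complex.sin (Real.pi * z) ^ 2)) z := by
    have hlin : HasDerivAt (fun x : ℂ => (Real.pi : ℂ) * x) (Real.pi : ℂ) z := by
      simpa using (hasDerivAt_id z).const_mul (Real.pi : ℂ)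
    have := ((hlin.ccos.div hlin.csin hs).const_mul (Real.pi : ℂ))
    refine (this.congr_deriv ?_)
    have := Complex.sin_sq_add_cos_sq (Real.pi * z)
    field_simp
    linear_combination (-1 : ℂ) * this
  rw [hd.deriv] at h
  simp at h
  simpa using h.symm

lemma kernel_upper {a : ℝ} (ha : 0 < a) {s : ℂ} (h0 : 0 < s.re) (hs : s.re < a)
    (hi : 0 < s.im) :
    (∫ k : ℝ, (wt a k : ℂ) * Complex.exp (-(k * s))) =
      2 * ((Real.pi : ℂ) / a) ^ 2 / Complex.sin (Real.pi * (s / a)) ^ 2 := by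
  rw [← (wt_hasSum_int ha h0 hs).tsum_eq]
  have hz : 0 < (s / a).im := by
    rw [Complex.div_ofReal_im]; positivity
  have ha' : (a : ℂ) ≠ 0 := by exact_mod_cast ha.ne'
  have := sin_series_upper hz
  have e : ∀ n : ℤ, 2 / (s + n * a) ^ 2 = 2 / (a:ℂ) ^ 2 * (1 / (s / a + n) ^ 2) := by
    intro n
    have : s + n * a = a * (s / a + n) := by field_simp
    rw [this, mul_pow, div_mul_div_comm, mul_one]
  simp_rw [e]
  rw [tsum_mul_left, this]
  ring

lemma kernel {a : ℝ} (ha : 0 < a) {s : ℂ} (h0 : 0 < s.re) (hs : s.re < a)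
    (hi : s.im ≠ 0) :
    (∫ k : ℝ, (wt a k : ℂ) * Complex.exp (-(k * s))) =
      2 * ((Real.pi : ℂ) / a) ^ 2 / Complex.sin (Real.pi * (s / a)) ^ 2 := by
  rcases lt_or_gt_of_ne hi with hi | hi
  · have h1 := kernel_upper ha (s := a - s) (by simpa using hs) (by simpa using h0) (by simpa using hi)
    have ha' : (a : ℂ) ≠ 0 := by exact_mod_cast ha.ne'
    have e : (Real.pi : ℂ) * ((a - s) / a) = Real.pi - Real.pi * (s / a) := by field_simp
    rw [e, Complex.sin_pi_sub] at h1
    rw [← h1, ← integral_neg_eq_self]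
    exact integral_congr_ae (.of_forall fun k => wt_refl s k)
  · exact kernel_upper ha h0 hs hi

lemma swap_exp (φ H : ℝ → ℂ) (hφ : Integrable φ) (hH : Integrable H) (c : ℂ) (hc : c.re = 0) :
    ∫ u : ℝ, φ u * ∫ k : ℝ, H k * Complex.exp (c * k * u) =
      ∫ k : ℝ, H k * ∫ u : ℝ, Complex.exp (c * k * u) * φ u := by
  simp_rw [← integral_const_mul]
  rw [integral_integral_swap]
  · refine integral_congr_ae (.of_forall fun k => integral_congr_ae (.of_forall fun u => ?_))
    dsimp only; ring
  · have h := (hφ.mul_prod hH).bdd_mul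
      (f := fun p : ℝ × ℝ => Complex.exp (c * p.2 * p.1)) (c := 1)
      (by fun_prop) (.of_forall fun p => by
        rw [Complex.norm_exp]; simp [hc])
    refine h.congr (.of_forall fun p => ?_)
    simp [Function.uncurry]; ring

lemma hat_facts (f : ℝ → ℂ) (hf : ContDiff ℝ (⊤ : ℕ∞) f) (hfc : HasCompactSupport f) :
    let F : ℝ → ℂ := fun k => ∫ x : ℝ, Complex.exp (Complex.I * k * x) * f x
    Continuous F ∧ (∃ C, ∀ k, ‖F k‖ ≤ C) ∧ Integrable F ∧ Integrable (fun k => |k| * ‖F k‖) := by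
  intro F
  let S : SchwartzMap ℝ ℂ := FourierTransform.fourier (hfc.toSchwartzMap hf)
  have hF : ∀ k, F k = S (-(2 * Real.pi)⁻¹ * k) := by
    intro k
    show _ = (FourierTransform.fourier (hfc.toSchwartzMap hf)) (-(2 * Real.pi)⁻¹ * k)
    rw [SchwartzMap.fourier_coe, Real.fourier_real_eq_integral_exp_smul]
    refine integral_congr_ae (.of_forall fun x => ?_)
    simp only [smul_eq_mul, HasCompactSupport.toSchwartzMap_toFun]
    congr 2
    push_cast
    have : (Real.pi : ℂ) ≠ 0 := by exact_mod_cast Real.pi_ne_zero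
    field_simp
  have hF' : F = fun k => S (-(2 * Real.pi)⁻¹ * k) := funext hF
  have hne : -(2 * Real.pi)⁻¹ ≠ 0 := by have := Real.pi_ne_zero; simp [this]
  refine ⟨?_, ?_, ?_, ?_⟩
  · rw [hF']; have := S.continuous; fun_prop
  · obtain ⟨C, hC⟩ := S.decay 0 0
    refine ⟨C, fun k => ?_⟩
    rw [hF]; simpa using hC.2 (-(2 * Real.pi)⁻¹ * k)
  · rw [hF']; exact (S.integrable (μ := volume)).comp_mul_left' hne
  · have := ((S.integrable_pow_mul volume 1).comp_mul_left' hne).const_mul (2 * Real.pi)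
    refine this.congr (.of_forall fun k => ?_)
    simp only [hF]
    rw [norm_mul, norm_neg, Real.norm_eq_abs, Real.norm_eq_abs, abs_of_pos (by positivity : 0 < (2 * Real.pi)⁻¹)]
    field_simp

lemma eps_formula {κ : ℝ} (hκ : 0 < κ) (f g : ℝ → ℂ) (hf : Integrable f) (hg : Integrable g)
    (G : ℝ → ℂ) (hG : ∀ k, G k = ∫ x : ℝ, Complex.exp (Complex.I * k * x) * g x)
    (F : ℝ → ℂ) (hF : ∀ k, F k = ∫ x : ℝ, Complex.exp (Complex.I * k * x) * f x)
    (hGc : Continuous G) {C : ℝ} (hGb : ∀ k, ‖G k‖ ≤ C)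
    {ε : ℝ} (h0 : 0 < ε) (h1 : ε < 2 * Real.pi / κ) :
    -((κ^2 : ℂ)/(4*(Real.pi : ℂ))) * ∫ u : ℝ, ∫ v : ℝ,
          (starRingEnd ℂ) (f u) * g v *
            ((Complex.sinh ((κ : ℂ) * ((u : ℂ) - (v : ℂ) - (ε : ℂ) * Complex.I) / 2)) ^ 2)⁻¹ =
    ∫ k : ℝ, (2 * (Real.pi : ℂ))⁻¹ * ((starRingEnd ℂ) (F k) * G k) *
      ((wt (2 * Real.pi / κ) k * Real.exp (-(k * ε)) : ℝ) : ℂ) := by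
  set a := 2 * Real.pi / κ with ha_def
  have ha : 0 < a := by positivity
  have hpi : (Real.pi : ℂ) ≠ 0 := by exact_mod_cast Real.pi_ne_zero
  have hκ' : (κ : ℂ) ≠ 0 := by exact_mod_cast hκ.ne'
  have hker : ∀ u v : ℝ, v ≠ u → -((κ^2 : ℂ)/(4*(Real.pi : ℂ))) *
      ((Complex.sinh ((κ : ℂ) * ((u : ℂ) - (v : ℂ) - (ε : ℂ) * Complex.I) / 2)) ^ 2)⁻¹ =
      (2 * (Real.pi : ℂ))⁻¹ *
        ∫ k : ℝ, (wt a k : ℂ) * Complex.exp (-(k * (ε + (u - v) * Complex.I))) := by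
    intro u v huv
    rw [kernel ha (by simpa using h0) (by simpa using h1) (by simpa [sub_eq_zero] using huv.symm)]
    have e1 : (Real.pi : ℂ) * (((ε : ℂ) + (u - v) * Complex.I) / a) =
        ((κ : ℂ) * ((u : ℂ) - (v : ℂ) - (ε : ℂ) * Complex.I) / 2) * Complex.I := by
      rw [ha_def]; push_cast; field_simp
      linear_combination (ε:ℂ) * Complex.I_sq
    have e2 : (Real.pi : ℂ) / a = κ / 2 := by
      rw [ha_def]; push_cast; field_simp
    rw [e1, e2, Complex.sin_mul_I, mul_pow, Complex.I_sq]
    rw [mul_neg_one, div_neg, div_eq_mul_inv]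
    field_simp
    ring
  have hwi : ∀ u : ℝ, Integrable (fun k : ℝ => (wt a k : ℂ) * Complex.exp (-(k * (ε + u * Complex.I)))) :=
    fun u => wt_integrable ha (by simpa using h0) (by simpa using h1)
  -- inner
  have hinner : ∀ u : ℝ, -((κ^2 : ℂ)/(4*(Real.pi : ℂ))) * (∫ v : ℝ,
          (starRingEnd ℂ) (f u) * g v *
            ((Complex.sinh ((κ : ℂ) * ((u : ℂ) - (v : ℂ) - (ε : ℂ) * Complex.I) / 2)) ^ 2)⁻¹) =
      (2 * (Real.pi : ℂ))⁻¹ * ((starRingEnd ℂ) (f u) * ∫ k : ℝ,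
        (G k * ((wt a k : ℂ) * Complex.exp (-(k * ε)))) * Complex.exp (-Complex.I * k * u)) := by
    intro u
    have hs := swap_exp g _ hg (hwi u) Complex.I (by simp)
    have e : ∀ k : ℝ, (G k * ((wt a k : ℂ) * Complex.exp (-(k * ε)))) * Complex.exp (-Complex.I * k * u)
        = (wt a k : ℂ) * Complex.exp (-(k * (ε + u * Complex.I))) *
          ∫ x : ℝ, Complex.exp (Complex.I * k * x) * g x := by
      intro k
      rw [← hG, show -((k:ℂ) * (ε + u * Complex.I)) = -(k * ε) + -Complex.I * k * u by ring,
        Complex.exp_add]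
      ring
    simp_rw [e]
    rw [← hs, ← integral_const_mul, ← integral_const_mul, ← integral_const_mul]
    refine integral_congr_ae ?_
    filter_upwards [compl_mem_ae_iff.mpr (measure_singleton u)] with v hv
    have hv : v ≠ u := hv
    have := hker u v hv
    have e3 : (∫ k : ℝ, (wt a k : ℂ) * Complex.exp (-(k * (ε + u * Complex.I))) *
        Complex.exp (Complex.I * k * v)) =
        ∫ k : ℝ, (wt a k : ℂ) * Complex.exp (-(k * (ε + (u - v) * Complex.I))) := by
      refine integral_congr_ae (.of_forall fun k => ?_)
      dsimp only
      rw [mul_assoc, ← Complex.exp_add]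
      congr 2; ring
    rw [e3]
    linear_combination ((starRingEnd ℂ) (f u) * g v) * this
  rw [← integral_const_mul]
  simp_rw [hinner]
  rw [integral_const_mul]
  have hHi : Integrable (fun k : ℝ => G k * ((wt a k : ℂ) * Complex.exp (-(k * ε)))) := by
    have := hwi 0
    simp only [Complex.ofReal_zero, zero_mul, add_zero] at this
    exact this.bdd_mul hGc.aestronglyMeasurable (.of_forall hGb)
  have hfc : Integrable (fun u => (starRingEnd ℂ) (f u)) :=
    (Complex.conjCLE.toContinuousLinearMap.integrable_comp hf)
  rw [swap_exp _ _ hfc hHi (-Complex.I) (by simp), ← integral_const_mul]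
  refine integral_congr_ae (.of_forall fun k => ?_)
  dsimp only
  have : (∫ u : ℝ, Complex.exp (-Complex.I * k * u) * (starRingEnd ℂ) (f u)) = (starRingEnd ℂ) (F k) := by
    rw [hF, ← integral_conj]
    refine integral_congr_ae (.of_forall fun u => ?_)
    simp [← Complex.exp_conj]
  rw [this]
  push_cast
  ring

/-- Restriction of the horizon two-point function to one wedge, in the Killing
coordinate `u`: for smooth compactly supported `f, g`,
`lim_{ε→0⁺} −(κ²/(4π)) ∫∫ conj(f(u)) g(v) (sinh(κ(u − v − iε)/2))^{−2} du dv
  = ∫ conj(f̂(k)) ĝ(k) w(k) dk`,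
where `w(k) = 2k e^{πk/κ}/(e^{πk/κ} − e^{−πk/κ})` for `k ≠ 0` and `w(0) = κ/π`. -/
theorem stmt_17 (κ : ℝ) (hκ : 0 < κ)
    (f g : ℝ → ℂ) (hf : ContDiff ℝ (⊤ : ℕ∞) f) (hfc : HasCompactSupport f)
    (hg : ContDiff ℝ (⊤ : ℕ∞) g) (hgc : HasCompactSupport g)
    (fhat ghat : ℝ → ℂ)
    (hfhat : ∀ k : ℝ, fhat k =
      (((2*Real.pi) ^ (-(1/2) : ℝ) : ℝ) : ℂ) * ∫ x : ℝ, Complex.exp (Complex.I * k * x) * f x)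
    (hghat : ∀ k : ℝ, ghat k =
      (((2*Real.pi) ^ (-(1/2) : ℝ) : ℝ) : ℂ) * ∫ x : ℝ, Complex.exp (Complex.I * k * x) * g x)
    (w : ℝ → ℝ)
    (hw0 : w 0 = κ/Real.pi)
    (hw : ∀ k : ℝ, k ≠ 0 → w k =
      2*k*Real.exp (Real.pi*k/κ) / (Real.exp (Real.pi*k/κ) - Real.exp (-(Real.pi*k/κ)))) :
    Tendsto (fun ε : ℝ =>
        -((κ^2 : ℂ)/(4*(Real.pi : ℂ))) * ∫ u : ℝ, ∫ v : ℝ,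
          (starRingEnd ℂ) (f u) * g v *
            ((Complex.sinh ((κ : ℂ) * ((u : ℂ) - (v : ℂ) - (ε : ℂ) * Complex.I) / 2)) ^ 2)⁻¹)
      (nhdsWithin 0 (Set.Ioi 0))
      (nhds (∫ k : ℝ, (starRingEnd ℂ) (fhat k) * ghat k * ((w k : ℝ) : ℂ))) := by
  set a := 2 * Real.pi / κ with ha_def
  have ha : 0 < a := by positivity
  have hpi : (0:ℝ) < Real.pi := Real.pi_pos
  obtain ⟨hFc, ⟨CF, hFb⟩, hFi, hFi1⟩ := hat_facts f hf hfc
  obtain ⟨hGc, ⟨CG, hGb⟩, hGi, hGi1⟩ := hat_facts g hg hgc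
  set F : ℝ → ℂ := fun k => ∫ x : ℝ, Complex.exp (Complex.I * k * x) * f x with hF
  set G : ℝ → ℂ := fun k => ∫ x : ℝ, Complex.exp (Complex.I * k * x) * g x with hG
  have hc : ((((2*Real.pi) ^ (-(1/2) : ℝ) : ℝ) : ℂ)) * (((2*Real.pi) ^ (-(1/2) : ℝ) : ℝ) : ℂ)
      = (2 * (Real.pi : ℂ))⁻¹ := by
    rw [← Complex.ofReal_mul, ← Real.rpow_add (by positivity)]
    norm_num [Real.rpow_neg_one]
  have hlim : (∫ k : ℝ, (starRingEnd ℂ) (fhat k) * ghat k * ((w k : ℝ) : ℂ)) =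
      ∫ k : ℝ, (2 * (Real.pi : ℂ))⁻¹ * ((starRingEnd ℂ) (F k) * G k) *
        ((wt a k : ℝ) : ℂ) := by
    refine integral_congr_ae ?_
    filter_upwards [compl_mem_ae_iff.mpr (measure_singleton (0:ℝ))] with k hk
    have hk : k ≠ 0 := hk
    have hwk : w k = wt a k := by
      rw [hw k hk]
      unfold wt
      have e1 : Real.exp (-(a * k)) = Real.exp (-(Real.pi*k/κ)) / Real.exp (Real.pi*k/κ) := by
        rw [← Real.exp_sub, ha_def]; congr 1; field_simp; ring
      rw [e1]
      have hp := Real.exp_pos (Real.pi*k/κ)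
      rw [one_sub_div hp.ne', div_div_eq_mul_div]
    rw [hwk, hfhat, hghat, ← hc, map_mul, Complex.conj_ofReal]
    ring
  rw [hlim]
  have hev : ∀ᶠ ε : ℝ in nhdsWithin 0 (Set.Ioi 0), 0 < ε ∧ ε < a := by
    filter_upwards [Ioo_mem_nhdsGT ha] with ε hε using hε
  have hfi : Integrable f := hf.continuous.integrable_of_hasCompactSupport hfc
  have hgi : Integrable g := hg.continuous.integrable_of_hasCompactSupport hgc
  have heq : (fun ε : ℝ => ∫ k : ℝ, (2 * (Real.pi : ℂ))⁻¹ * ((starRingEnd ℂ) (F k) * G k) *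
      ((wt a k * Real.exp (-(k * ε)) : ℝ) : ℂ)) =ᶠ[nhdsWithin 0 (Set.Ioi 0)] (fun ε : ℝ =>
        -((κ^2 : ℂ)/(4*(Real.pi : ℂ))) * ∫ u : ℝ, ∫ v : ℝ,
          (starRingEnd ℂ) (f u) * g v *
            ((Complex.sinh ((κ : ℂ) * ((u : ℂ) - (v : ℂ) - (ε : ℂ) * Complex.I) / 2)) ^ 2)⁻¹) := by
    filter_upwards [hev] with ε hε
    exact (eps_formula hκ f g hfi hgi G (fun _ => rfl) F (fun _ => rfl) hGc hGb hε.1 hε.2).symm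
  refine Tendsto.congr' heq ?_
  refine tendsto_integral_filter_of_dominated_convergence
    (fun k => (2 * Real.pi)⁻¹ * CF * (2 / a * ‖G k‖ + 2 * (|k| * ‖G k‖))) ?_ ?_ ?_ ?_
  · refine .of_forall fun ε => ?_
    have hm := wt_meas a
    have hFm := hFc.measurable
    have hGm := hGc.measurable
    have hcj : Measurable (fun k => (starRingEnd ℂ) (F k)) :=
      (Complex.continuous_conj.comp hFc).measurable
    exact ((measurable_const.mul (hcj.mul hGm)).mul
      (Complex.measurable_ofReal.comp (hm.mul (by fun_prop)))).aestronglyMeasurable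
  · filter_upwards [hev] with ε hε
    refine .of_forall fun k => ?_
    have hb := wt_bound ha hε.1.le hε.2.le k
    have hn : 0 ≤ wt a k * Real.exp (-(k * ε)) := mul_nonneg (wt_nonneg ha k) (Real.exp_pos _).le
    have hCF : 0 ≤ CF := (norm_nonneg _).trans (hFb 0)
    rw [norm_mul, norm_mul, norm_mul, Complex.norm_real, Real.norm_of_nonneg hn, RCLike.norm_conj]
    have e : ‖(2 * (Real.pi : ℂ))⁻¹‖ = (2 * Real.pi)⁻¹ := by
      rw [norm_inv, norm_mul, Complex.norm_real, Real.norm_of_nonneg hpi.le]; simp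
    rw [e]
    calc _ ≤ (2 * Real.pi)⁻¹ * (CF * ‖G k‖) * (2 / a + 2 * |k|) := by
          gcongr
          exact hFb k
      _ = _ := by ring
  · exact ((hGi.norm.const_mul _).add (hGi1.const_mul _)).const_mul _
  · refine .of_forall fun k => ?_
    have : Continuous (fun ε : ℝ => (2 * (Real.pi : ℂ))⁻¹ * ((starRingEnd ℂ) (F k) * G k) *
      ((wt a k * Real.exp (-(k * ε)) : ℝ) : ℂ)) := by fun_prop
    have h := this.tendsto 0
    simp only [mul_zero, neg_zero, Real.exp_zero, mul_one] at h
    exact h.mono_left nhdsWithin_le_nhds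
end

section
/- Let κ > 0 and define w : ℝ → ℝ by w(k) := k·e^{πk/κ}/(e^{πk/κ} − e^{−πk/κ}) for k ≠ 0 and w(0) := κ/(2π). Then: (i) w satisfies the detailed-balance relation w(−k) = e^{−2πk/κ}·w(k) for every real k; and (ii) for all continuous compactly supported F, G : ℝ → ℂ satisfying the reality conditions F(−k) = conj(F(k)) and G(−k) = conj(G(k)) for all k, and for every τ ∈ ℝ, ∫_ℝ e^{−iτk}·conj(F(k))·G(k)·w(k) dk = ∫_ℝ conj(G(k))·e^{iτk}·e^{−2πk/κ}·F(k)·w(k) dk. (This is the KMS condition at inverse temperature β = 2π/κ for the horizon state with respect to the Killing time translations.) -/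
open MeasureTheory Filter

/-- KMS condition at inverse temperature `β = 2π/κ` for the thermal density
`w(k) = k e^{πk/κ}/(e^{πk/κ} − e^{−πk/κ})` (with `w(0) = κ/(2π)`):
(i) detailed balance `w(−k) = e^{−2πk/κ} w(k)`; (ii) for continuous compactly
supported `F, G` satisfying the reality conditions `F(−k) = conj F(k)`,
`G(−k) = conj G(k)`, and for every `τ`,
`∫ e^{−iτk} conj(F(k)) G(k) w(k) dk = ∫ conj(G(k)) e^{iτk} e^{−2πk/κ} F(k) w(k) dk`. -/
theorem stmt_18 (κ : ℝ) (hκ : 0 < κ)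
    (w : ℝ → ℝ)
    (hw0 : w 0 = κ/(2*Real.pi))
    (hw : ∀ k : ℝ, k ≠ 0 → w k =
      k * Real.exp (Real.pi*k/κ) / (Real.exp (Real.pi*k/κ) - Real.exp (-(Real.pi*k/κ)))) :
    (∀ k : ℝ, w (-k) = Real.exp (-(2*Real.pi*k/κ)) * w k) ∧
    (∀ F G : ℝ → ℂ, Continuous F → HasCompactSupport F →
      Continuous G → HasCompactSupport G →
      (∀ k : ℝ, F (-k) = (starRingEnd ℂ) (F k)) →
      (∀ k : ℝ, G (-k) = (starRingEnd ℂ) (G k)) →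
      ∀ τ : ℝ,
        (∫ k : ℝ, Complex.exp (-(Complex.I * (τ : ℂ) * (k : ℂ))) *
            (starRingEnd ℂ) (F k) * G k * ((w k : ℝ) : ℂ)) =
        ∫ k : ℝ, (starRingEnd ℂ) (G k) * Complex.exp (Complex.I * (τ : ℂ) * (k : ℂ)) *
            ((Real.exp (-(2*Real.pi*k/κ)) : ℝ) : ℂ) * F k * ((w k : ℝ) : ℂ)) := by
  have h1 : ∀ k : ℝ, w (-k) = Real.exp (-(2*Real.pi*k/κ)) * w k := by
    intro k
    by_cases hk : k = 0
    · subst hk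
      simp
    · rw [hw k hk, hw (-k) (neg_ne_zero.mpr hk)]
      have e1 : Real.pi * (-k) / κ = -(Real.pi * k / κ) := by ring
      have e2 : Real.exp (-(2*Real.pi*k/κ)) * Real.exp (Real.pi*k/κ)
          = Real.exp (-(Real.pi*k/κ)) := by
        rw [← Real.exp_add]
        congr 1
        ring
      rw [e1, neg_neg, ← mul_div_assoc, mul_left_comm, e2,
        ← neg_sub (Real.exp (Real.pi*k/κ)), neg_mul, neg_div_neg_eq]
  refine ⟨h1, ?_⟩
  intro F G _ _ _ _ hF hG τ
  rw [← integral_neg_eq_self]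
  congr 1
  funext k
  rw [h1, hF, hG, Complex.conj_conj]
  push_cast
  rw [mul_neg, neg_neg]
  ring
end

section
/- Let a > 0. For all f, g ∈ C_c^∞(ℝ, ℂ), both limits lim_{ε→0⁺} −(1/π) ∫_ℝ ∫_ℝ conj(f(ax))·g(ay)·(x − y − iε)^{−2} dx dy and lim_{ε→0⁺} −(1/π) ∫_ℝ ∫_ℝ conj(f(x))·g(y)·(x − y − iε)^{−2} dx dy exist and are equal. (This is the invariance of the horizon two-point function under the dilations U ↦ e^{κτ}U of the affine horizon coordinate, i.e. under the one-parameter group generated by the Killing vector; it implies the invariance of the induced quasifree state.) -/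
open MeasureTheory Filter

theorem aux_ibp (u v v' : ℝ → ℂ) (hu : ContDiff ℝ (⊤ : ℕ∞) u) (huc : HasCompactSupport u)
    (hv : ∀ x, HasDerivAt v (v' x) x) (hv' : Continuous v') :
    ∫ x, u x * v' x = - ∫ x, deriv u x * v x := by
  have hvc : Continuous v := continuous_iff_continuousAt.2 fun x => (hv x).continuousAt
  have hd : Continuous (deriv u) := hu.continuous_deriv (by simp)
  apply integral_mul_deriv_eq_deriv_mul_of_integrable
    (fun x _ => (hu.differentiable (by simp) x).hasDerivAt) (fun x _ => hv x)
  · exact (hu.continuous.mul hv').integrable_of_hasCompactSupport huc.mul_right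
  · exact (hd.mul hvc).integrable_of_hasCompactSupport huc.deriv.mul_right
  · exact (hu.continuous.mul hvc).integrable_of_hasCompactSupport huc.mul_right

/-- third primitive -/
noncomputable def auxK (ε x y : ℝ) : ℂ :=
  ((x : ℂ) - (y : ℂ) - (ε : ℂ) * Complex.I) *
    Complex.log ((x : ℂ) - (y : ℂ) - (ε : ℂ) * Complex.I) -
    ((x : ℂ) - (y : ℂ) - (ε : ℂ) * Complex.I)

theorem aux_slit (ε x y : ℝ) (hε : 0 < ε) :
    ((x : ℂ) - (y : ℂ) - (ε : ℂ) * Complex.I) ∈ Complex.slitPlane := by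
  rw [Complex.mem_slitPlane_iff]; right; simp; exact hε.ne'

theorem aux_contK (ε : ℝ) (hε : 0 < ε) : Continuous (fun p : ℝ × ℝ => auxK ε p.1 p.2) := by
  unfold auxK
  have h : Continuous (fun p : ℝ × ℝ => ((p.1 : ℂ) - (p.2 : ℂ) - (ε : ℂ) * Complex.I)) := by
    fun_prop
  exact (h.mul (h.clog fun p => aux_slit ε p.1 p.2 hε)).sub h

theorem aux_inner (g : ℝ → ℂ) (hg : ContDiff ℝ (⊤ : ℕ∞) g) (hgc : HasCompactSupport g)
    (ε x : ℝ) (hε : 0 < ε) :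
    ∫ y : ℝ, g y * (((x : ℂ) - (y : ℂ) - (ε : ℂ) * Complex.I) ^ 2)⁻¹ =
      - ∫ y : ℝ, deriv (deriv (deriv g)) y * auxK ε x y := by
  have hs := fun y => aux_slit ε x y hε
  have hz : ∀ y : ℝ, HasDerivAt (fun y : ℝ => (x : ℂ) - (y : ℂ) - (ε : ℂ) * Complex.I) (-1) y := by
    intro y
    have := ((Complex.ofRealCLM.hasDerivAt (x := y)).const_sub (x : ℂ)).sub_const
      ((ε : ℂ) * Complex.I)
    simpa using this
  have hc : Continuous (fun y : ℝ => (x : ℂ) - (y : ℂ) - (ε : ℂ) * Complex.I) := by fun_prop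
  have hn : ∀ y : ℝ, (x : ℂ) - (y : ℂ) - (ε : ℂ) * Complex.I ≠ 0 := fun y =>
    Complex.slitPlane_ne_zero (hs y)
  have hg1 : ContDiff ℝ (⊤ : ℕ∞) (deriv g) := (contDiff_infty_iff_deriv.1 hg).2
  have hg2 : ContDiff ℝ (⊤ : ℕ∞) (deriv (deriv g)) := (contDiff_infty_iff_deriv.1 hg1).2
  rw [aux_ibp g (fun y => ((x : ℂ) - (y : ℂ) - (ε : ℂ) * Complex.I)⁻¹) _ hg hgc ?_ ?_,
    aux_ibp (deriv g) (fun y => - Complex.log ((x : ℂ) - (y : ℂ) - (ε : ℂ) * Complex.I))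
      _ hg1 hgc.deriv ?_ ?_,
    aux_ibp (deriv (deriv g)) (fun y => auxK ε x y) _ hg2 hgc.deriv.deriv ?_ ?_, neg_neg]
  · intro y
    unfold auxK
    refine HasDerivAt.congr_deriv (((hz y).mul ((hz y).clog_real (hs y))).sub (hz y)) ?_
    have := hn y
    field_simp
    ring
  · exact (hc.clog hs).neg
  · intro y
    refine HasDerivAt.congr_deriv (((hz y).clog_real (hs y)).neg) ?_
    have := hn y
    field_simp
  · exact hc.inv₀ hn
  · intro y
    refine HasDerivAt.congr_deriv ((hz y).inv (hn y)) ?_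
    have := hn y
    field_simp
  · exact (hc.pow 2).inv₀ fun y => pow_ne_zero 2 (hn y)

theorem aux_boundK (ε x y : ℝ) (hε : 0 < ε) (h1 : ε ≤ 1) :
    ‖auxK ε x y‖ ≤ 20 * (1 + |x|)^2 * (1 + |y|)^2 := by
  unfold auxK
  set z : ℂ := (x : ℂ) - (y : ℂ) - (ε : ℂ) * Complex.I with hz
  have hz0 : z ≠ 0 := Complex.slitPlane_ne_zero (aux_slit ε x y hε)
  have hzp : 0 < ‖z‖ := norm_pos_iff.2 hz0
  have hzn : ‖z‖ ≤ |x| + |y| + 1 := by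
    have e1 : ‖z‖ ≤ ‖(x:ℂ)‖ + ‖(y:ℂ)‖ + ‖(ε:ℂ) * Complex.I‖ :=
      (norm_sub_le _ _).trans (by gcongr; exact norm_sub_le _ _)
    simp [abs_of_pos hε] at e1
    linarith
  have hlog : ‖z‖ * |Real.log ‖z‖| ≤ 1 + ‖z‖ ^ 2 := by
    rcases le_total ‖z‖ 1 with h | h
    · have := Real.abs_log_mul_self_lt ‖z‖ hzp h
      rw [abs_mul, abs_of_pos hzp] at this
      nlinarith [sq_nonneg ‖z‖]
    · rw [abs_of_nonneg (Real.log_nonneg h)]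
      nlinarith [Real.log_le_sub_one_of_pos hzp]
  have hl : ‖Complex.log z‖ ≤ |Real.log ‖z‖| + 4 := by
    have := Complex.norm_le_abs_re_add_abs_im (Complex.log z)
    rw [Complex.log_re, Complex.log_im] at this
    linarith [Complex.abs_arg_le_pi z, Real.pi_lt_four]
  have h2 : ‖z * Complex.log z - z‖ ≤ ‖z‖ * ‖Complex.log z‖ + ‖z‖ := by
    rw [← norm_mul]; exact norm_sub_le _ _
  have h3 : ‖z‖ * ‖Complex.log z‖ ≤ ‖z‖ * (|Real.log ‖z‖| + 4) := by gcongr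
  have h4 : ‖z * Complex.log z - z‖ ≤ 1 + ‖z‖^2 + 5 * ‖z‖ := by nlinarith
  have hx := abs_nonneg x
  have hy := abs_nonneg y
  have h5 : |x| + |y| + 1 ≤ (1 + |x|) * (1 + |y|) := by nlinarith
  have h6 : ‖z‖ ≤ (1 + |x|) * (1 + |y|) := hzn.trans h5
  have h7 : 1 ≤ (1 + |x|) * (1 + |y|) := by nlinarith
  rw [mul_assoc, ← mul_pow]
  nlinarith

theorem aux_limK (x y : ℝ) (hxy : y ≠ x) :
    ∃ l : ℂ, Tendsto (fun ε : ℝ => auxK ε x y) (nhdsWithin 0 (Set.Ioi 0)) (nhds l) := by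
  have hz : Tendsto (fun ε : ℝ => (x : ℂ) - (y : ℂ) - (ε : ℂ) * Complex.I)
      (nhdsWithin 0 (Set.Ioi 0)) (nhds ((x - y : ℝ) : ℂ)) := by
    have : Continuous (fun ε : ℝ => (x : ℂ) - (y : ℂ) - (ε : ℂ) * Complex.I) := by fun_prop
    have h := this.tendsto 0
    simp at h
    push_cast
    exact h.mono_left nhdsWithin_le_nhds
  have hl : ∃ m : ℂ, Tendsto (fun ε : ℝ => Complex.log ((x : ℂ) - (y : ℂ) - (ε : ℂ) * Complex.I))
      (nhdsWithin 0 (Set.Ioi 0)) (nhds m) := by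
    rcases lt_or_gt_of_ne hxy with h | h
    · exact ⟨_, hz.clog (Complex.ofReal_mem_slitPlane.2 (by linarith))⟩
    · refine ⟨_, (Complex.tendsto_log_nhdsWithin_im_neg_of_re_neg_of_im_zero
        (z := ((x - y : ℝ) : ℂ)) (by rw [Complex.ofReal_re]; linarith) (by simp only [Complex.ofReal_im])).comp
        (tendsto_nhdsWithin_iff.2 ⟨hz, ?_⟩)⟩
      filter_upwards [self_mem_nhdsWithin] with ε hε
      simpa using hε
  obtain ⟨m, hm⟩ := hl
  exact ⟨_, (hz.mul hm).sub hz⟩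

theorem aux_lim (f g : ℝ → ℂ) (hf : ContDiff ℝ (⊤ : ℕ∞) f) (hfc : HasCompactSupport f)
    (hg : ContDiff ℝ (⊤ : ℕ∞) g) (hgc : HasCompactSupport g) :
    ∃ L : ℂ,
      Tendsto (fun ε : ℝ =>
          -(1/(Real.pi : ℂ)) * ∫ x : ℝ, ∫ y : ℝ,
            (starRingEnd ℂ) (f x) * g y *
              (((x : ℂ) - (y : ℂ) - (ε : ℂ) * Complex.I) ^ 2)⁻¹)
        (nhdsWithin 0 (Set.Ioi 0)) (nhds L) := by
  have hg1 : ContDiff ℝ (⊤ : ℕ∞) (deriv g) := (contDiff_infty_iff_deriv.1 hg).2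
  have hg2 : ContDiff ℝ (⊤ : ℕ∞) (deriv (deriv g)) := (contDiff_infty_iff_deriv.1 hg1).2
  have hg3 : Continuous (deriv (deriv (deriv g))) := hg2.continuous_deriv (by simp)
  have hg3c : HasCompactSupport (deriv (deriv (deriv g))) := hgc.deriv.deriv.deriv
  set G := deriv (deriv (deriv g)) with hG
  have hev : ∀ᶠ ε : ℝ in nhdsWithin 0 (Set.Ioi 0), 0 < ε ∧ ε ≤ 1 := by
    filter_upwards [Ioc_mem_nhdsGT (zero_lt_one' ℝ)] with ε h using h
  have hbi : Integrable (fun y : ℝ => ‖G y‖ * (1 + |y|)^2) := by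
    apply Continuous.integrable_of_hasCompactSupport (by fun_prop)
    exact hg3c.norm.mul_right
  have hbound : ∀ ε x y : ℝ, 0 < ε → ε ≤ 1 →
      ‖G y * auxK ε x y‖ ≤ 20 * (1 + |x|)^2 * (‖G y‖ * (1 + |y|)^2) := by
    intro ε x y h0 h1
    rw [norm_mul]
    have := mul_le_mul_of_nonneg_left (aux_boundK ε x y h0 h1) (norm_nonneg (G y))
    linarith
  have hin : ∀ x : ℝ, ∃ l : ℂ, Tendsto (fun ε : ℝ => ∫ y : ℝ, G y * auxK ε x y)
      (nhdsWithin 0 (Set.Ioi 0)) (nhds l) := by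
    intro x
    choose l hl using fun (y : {y : ℝ // y ≠ x}) => aux_limK x y.1 y.2
    classical
    refine ⟨∫ y, G y * (if h : y ≠ x then l ⟨y, h⟩ else 0), ?_⟩
    apply tendsto_integral_filter_of_dominated_convergence
      (fun y => 20 * (1 + |x|)^2 * (‖G y‖ * (1 + |y|)^2))
    · filter_upwards [hev] with ε hε
      have : Continuous (fun y => auxK ε x y) :=
        (aux_contK ε hε.1).comp (by fun_prop : Continuous fun y : ℝ => (x, y))
      exact (hg3.mul this).aestronglyMeasurable
    · filter_upwards [hev] with ε hε
      exact Eventually.of_forall fun y => hbound ε x y hε.1 hε.2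
    · exact hbi.const_mul _
    · have : ∀ᵐ y : ℝ, y ≠ x := by
        simp [ae_iff]
      filter_upwards [this] with y hy
      rw [dif_pos hy]
      exact (hl ⟨y, hy⟩).const_mul _
  choose l hl using hin
  refine ⟨-(1/(Real.pi : ℂ)) * ∫ x, (starRingEnd ℂ) (f x) * -l x, ?_⟩
  apply Tendsto.const_mul
  have hcong : (fun ε : ℝ => ∫ x : ℝ, (starRingEnd ℂ) (f x) * -∫ y, G y * auxK ε x y)
      =ᶠ[nhdsWithin 0 (Set.Ioi 0)] (fun ε : ℝ => ∫ x : ℝ, ∫ y : ℝ,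
            (starRingEnd ℂ) (f x) * g y *
              (((x : ℂ) - (y : ℂ) - (ε : ℂ) * Complex.I) ^ 2)⁻¹) := by
    filter_upwards [hev] with ε hε
    congr 1
    ext x
    rw [hG, ← aux_inner g hg hgc ε x hε.1, ← integral_const_mul]
    simp only [mul_assoc]
  refine Tendsto.congr' hcong ?_
  have hfcont := hf.continuous
  apply tendsto_integral_filter_of_dominated_convergence
    (fun x => ‖f x‖ * ((20 * (1 + |x|)^2) * ∫ y, ‖G y‖ * (1 + |y|)^2))
  · filter_upwards [hev] with ε hε
    have hm : StronglyMeasurable (fun p : ℝ × ℝ => G p.2 * auxK ε p.1 p.2) :=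
      ((hg3.comp continuous_snd).mul (aux_contK ε hε.1)).stronglyMeasurable
    have h2 : StronglyMeasurable (fun x : ℝ => ∫ y, G y * auxK ε x y) :=
      hm.integral_prod_right
    exact ((Complex.continuous_conj.comp hfcont).stronglyMeasurable.mul h2.neg).aestronglyMeasurable
  · filter_upwards [hev] with ε hε
    refine Eventually.of_forall fun x => ?_
    rw [norm_mul, norm_neg, RCLike.norm_conj, ← integral_const_mul]
    gcongr
    exact norm_integral_le_of_norm_le (hbi.const_mul _)
      (Eventually.of_forall fun y => hbound ε x y hε.1 hε.2)
  · apply Continuous.integrable_of_hasCompactSupport (by fun_prop)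
    exact hfc.norm.mul_right
  · exact Eventually.of_forall fun x => ((hl x).neg).const_mul _

theorem aux_scale (a : ℝ) (ha : 0 < a) (f g : ℝ → ℂ) (ε : ℝ) :
    ∫ x : ℝ, ∫ y : ℝ, (starRingEnd ℂ) (f (a*x)) * g (a*y) *
              (((x : ℂ) - (y : ℂ) - (ε : ℂ) * Complex.I) ^ 2)⁻¹ =
    ∫ x : ℝ, ∫ y : ℝ, (starRingEnd ℂ) (f x) * g y *
              (((x : ℂ) - (y : ℂ) - ((a * ε : ℝ) : ℂ) * Complex.I) ^ 2)⁻¹ := by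
  have hac : (a : ℂ) ≠ 0 := by exact_mod_cast ha.ne'
  set H : ℝ → ℝ → ℂ := fun x y => (starRingEnd ℂ) (f x) * g y *
              (((x : ℂ) - (y : ℂ) - ((a * ε : ℝ) : ℂ) * Complex.I) ^ 2)⁻¹ with hH
  have h1 : ∀ x y : ℝ, (starRingEnd ℂ) (f (a*x)) * g (a*y) *
              (((x : ℂ) - (y : ℂ) - (ε : ℂ) * Complex.I) ^ 2)⁻¹ = (a:ℂ)^2 * H (a*x) (a*y) := by
    intro x y
    have : (((a*x : ℝ) : ℂ) - ((a*y : ℝ) : ℂ) - ((a * ε : ℝ) : ℂ) * Complex.I) =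
      a * ((x : ℂ) - (y : ℂ) - (ε : ℂ) * Complex.I) := by push_cast; ring
    simp only [hH]
    rw [this, mul_pow, mul_inv]
    field_simp
  simp only [h1]
  have h2 : ∀ x : ℝ, ∫ y : ℝ, (a:ℂ)^2 * H (a*x) (a*y) = a * ∫ y, H (a*x) y := by
    intro x
    rw [integral_const_mul, Measure.integral_comp_mul_left (fun y => H (a*x) y) a,
      abs_of_pos (inv_pos.2 ha), Complex.real_smul]
    push_cast
    field_simp
  simp only [h2]
  rw [integral_const_mul, Measure.integral_comp_mul_left (fun x => ∫ y, H x y) a,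
      abs_of_pos (inv_pos.2 ha), Complex.real_smul]
  rw [← mul_assoc, Complex.ofReal_inv, mul_inv_cancel₀ hac, one_mul]

/-- Dilation invariance of the horizon two-point function: for `a > 0` and smooth
compactly supported `f, g`, the limits
`lim_{ε→0⁺} −(1/π) ∫∫ conj(f(ax)) g(ay) (x − y − iε)^{−2} dx dy` and
`lim_{ε→0⁺} −(1/π) ∫∫ conj(f(x)) g(y) (x − y − iε)^{−2} dx dy`
both exist and are equal. -/
theorem stmt_19 (a : ℝ) (ha : 0 < a)
    (f g : ℝ → ℂ) (hf : ContDiff ℝ (⊤ : ℕ∞) f) (hfc : HasCompactSupport f)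
    (hg : ContDiff ℝ (⊤ : ℕ∞) g) (hgc : HasCompactSupport g) :
    ∃ L : ℂ,
      Tendsto (fun ε : ℝ =>
          -(1/(Real.pi : ℂ)) * ∫ x : ℝ, ∫ y : ℝ,
            (starRingEnd ℂ) (f (a*x)) * g (a*y) *
              (((x : ℂ) - (y : ℂ) - (ε : ℂ) * Complex.I) ^ 2)⁻¹)
        (nhdsWithin 0 (Set.Ioi 0)) (nhds L) ∧
      Tendsto (fun ε : ℝ =>
          -(1/(Real.pi : ℂ)) * ∫ x : ℝ, ∫ y : ℝ,
            (starRingEnd ℂ) (f x) * g y *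
              (((x : ℂ) - (y : ℂ) - (ε : ℂ) * Complex.I) ^ 2)⁻¹)
        (nhdsWithin 0 (Set.Ioi 0)) (nhds L) := by
  obtain ⟨L, hL⟩ := aux_lim f g hf hfc hg hgc
  refine ⟨L, ?_, hL⟩
  have ht : Tendsto (fun ε : ℝ => a * ε) (nhdsWithin 0 (Set.Ioi 0)) (nhdsWithin 0 (Set.Ioi 0)) := by
    refine tendsto_nhdsWithin_iff.2 ⟨?_, ?_⟩
    · have h : Tendsto (fun ε : ℝ => a * ε) (nhds 0) (nhds (a * 0)) :=
        (continuous_const.mul continuous_id).tendsto 0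
      rw [mul_zero] at h
      exact h.mono_left nhdsWithin_le_nhds
    · filter_upwards [self_mem_nhdsWithin] with ε hε
      exact mul_pos ha hε
  refine (hL.comp ht).congr fun ε => ?_
  simp only [Function.comp]
  rw [aux_scale a ha f g ε]
end
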